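/- arXiv:2503.18228 — 2 statements merged into one kernel-verified Lean document; each statement's English description precedes it below -/
import Mathlib

section
/- Let N ≥ 0 be a real number and let M : [1, ∞) → ℂ be a locally integrable function. Suppose there exist constants c > 0 and σ₀ > 0 such that for all σ ∈ (0, σ₀), ∫_1^∞ |M(x)| / x^{1+σ} dx ≥ c / σ^{N+1}. Then limsup_{x→∞} |M(x)| / (log x)^N > 0, i.e., M(x) is not o((log x)^N) as x → ∞. -/
open Filter MeasureTheory

/-- A power of the logarithm is bounded by a small power of `x`, uniformly in the exponent. -/
lemma log_rpow_le_mul_rpow_half {N σ x : ℝ} (hN : 0 ≤ N) (hσ : 0 < σ) (hx : 1 < x) :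
    Real.log x ^ N ≤ (2 * (N + 1)) ^ N / σ ^ N * x ^ (σ / 2) := by
  have hx0 : 0 < x := by linarith
  have hN1 : 0 < N + 1 := by linarith
  have hε : 0 < σ / (2 * (N + 1)) := by positivity
  have h1 : Real.log x ^ N ≤ (x ^ (σ / (2 * (N + 1))) / (σ / (2 * (N + 1)))) ^ N :=
    Real.rpow_le_rpow (Real.log_nonneg hx.le) (Real.log_le_rpow_div hx0.le hε) hN
  refine h1.trans ?_
  rw [Real.div_rpow (by positivity) hε.le, Real.div_rpow hσ.le (by positivity),
    ← Real.rpow_mul hx0.le, div_div_eq_mul_div, mul_comm, mul_div_right_comm]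
  gcongr
  · exact hx.le
  · rw [div_mul_eq_mul_div, div_le_div_iff₀ (by positivity) (by norm_num)]
    nlinarith

/-- If `‖M x‖ < ε (log x)^N` beyond `X`, then the weighted integral of `‖M‖` is bounded by a
constant plus a multiple of `ε / σ^{N+1}`. -/
lemma setIntegral_norm_div_rpow_le {N σ ε X : ℝ} {M : ℝ → ℂ} (hN : 0 ≤ N) (hσ : 0 < σ)
    (hε : 0 < ε) (hM : IntegrableOn M (Set.Ioc 1 X))
    (hX : ∀ x, X < x → ‖M x‖ / Real.log x ^ N < ε) :
    ∫ x in Set.Ioi (1 : ℝ), ‖M x‖ / x ^ (1 + σ) ≤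
      (∫ x in Set.Ioc 1 X, ‖M x‖) + 2 * ε * (2 * (N + 1)) ^ N / σ ^ (N + 1) := by
  have hN1 : 0 < N + 1 := by linarith
  set D := (2 * (N + 1)) ^ N with hD
  have hD0 : 0 < D := by positivity
  have hσN : 0 < σ ^ N := by positivity
  have hint1 : Integrable ((Set.Ioc 1 X).indicator fun x => ‖M x‖)
      (volume.restrict (Set.Ioi 1)) :=
    ((integrable_indicator_iff measurableSet_Ioc).2 hM.norm).restrict
  have hint2 : Integrable (fun x : ℝ => ε * (D / σ ^ N) * x ^ (-1 - σ / 2))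
      (volume.restrict (Set.Ioi 1)) :=
    (integrableOn_Ioi_rpow_of_lt (by linarith) one_pos).const_mul _
  have hle : ∫ x in Set.Ioi (1 : ℝ), ‖M x‖ / x ^ (1 + σ) ≤
      ∫ x in Set.Ioi (1 : ℝ), ((Set.Ioc 1 X).indicator (fun x => ‖M x‖) x +
        ε * (D / σ ^ N) * x ^ (-1 - σ / 2)) := by
    refine integral_mono_of_nonneg ?_ (hint1.add hint2) ?_
    · filter_upwards [ae_restrict_mem measurableSet_Ioi] with x hx
      have hx0 : (0 : ℝ) < x := one_pos.trans hx
      simp only [Pi.zero_apply]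
      positivity
    · filter_upwards [ae_restrict_mem measurableSet_Ioi] with x hx
      have hx1 : (1 : ℝ) < x := hx
      have hx0 : (0 : ℝ) < x := one_pos.trans hx1
      by_cases hxX : x ≤ X
      · rw [Set.indicator_of_mem (Set.mem_Ioc.2 ⟨hx1, hxX⟩)]
        have h1 : ‖M x‖ / x ^ (1 + σ) ≤ ‖M x‖ :=
          div_le_self (norm_nonneg _) (Real.one_le_rpow hx1.le (by linarith))
        have h2 : 0 ≤ ε * (D / σ ^ N) * x ^ (-1 - σ / 2) := by positivity
        linarith
      · rw [Set.indicator_of_notMem (fun h => hxX h.2), zero_add]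
        have hlog : 0 < Real.log x ^ N := Real.rpow_pos_of_pos (Real.log_pos hx1) _
        have h1 := (div_lt_iff₀ hlog).1 (hX x (not_le.1 hxX))
        have h2 := log_rpow_le_mul_rpow_half hN hσ hx1
        rw [div_le_iff₀ (by positivity), mul_assoc, ← Real.rpow_add hx0]
        rw [show -1 - σ / 2 + (1 + σ) = σ / 2 by ring, mul_assoc]
        exact h1.le.trans (mul_le_mul_of_nonneg_left h2 hε.le)
  refine hle.trans (le_of_eq ?_)
  rw [integral_add hint1 hint2, setIntegral_indicator measurableSet_Ioc,
    Set.inter_eq_right.2 Set.Ioc_subset_Ioi_self, integral_const_mul,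
    integral_Ioi_rpow_of_lt (by linarith) one_pos, Real.one_rpow, Real.rpow_add_one hσ.ne']
  congr 1
  rw [show -1 - σ / 2 + 1 = -(σ / 2) by ring, neg_div_neg_eq]
  field_simp

/-- If `M` is locally integrable on `[1, ∞)` and
`∫_1^∞ |M x| / x^{1+σ} dx ≥ c / σ^{N+1}` for all small `σ > 0`, then
`M x = Ω((log x)^N)`, i.e. `limsup |M x|/(log x)^N > 0`. -/
theorem omega_bound_of_integral_lower_bound
    (N : ℝ) (hN : 0 ≤ N) (M : ℝ → ℂ)
    (hM : LocallyIntegrableOn M (Set.Ici 1))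
    (c σ₀ : ℝ) (hc : 0 < c) (hσ₀ : 0 < σ₀)
    (hlow : ∀ σ ∈ Set.Ioo (0 : ℝ) σ₀,
      c / σ ^ (N + 1) ≤ ∫ x in Set.Ioi (1 : ℝ), ‖M x‖ / x ^ (1 + σ)) :
    ∃ c' > 0, ∃ᶠ x : ℝ in atTop, c' ≤ ‖M x‖ / Real.log x ^ N := by
  have hN1 : 0 < N + 1 := by linarith
  set D := (2 * (N + 1)) ^ N with hD
  have hD0 : 0 < D := by positivity
  refine ⟨c / (4 * D), by positivity, fun hev => ?_⟩
  obtain ⟨X, hX⟩ := eventually_atTop.1 hev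
  have hMX : IntegrableOn M (Set.Ioc 1 X) :=
    (hM.integrableOn_compact_subset Set.Icc_subset_Ici_self isCompact_Icc).mono_set
      Set.Ioc_subset_Icc_self
  have hbound : ∀ σ ∈ Set.Ioo (0 : ℝ) σ₀,
      c / 2 * (σ ^ (N + 1))⁻¹ ≤ ∫ x in Set.Ioc 1 X, ‖M x‖ := by
    intro σ hσ
    have h := (hlow σ hσ).trans (setIntegral_norm_div_rpow_le hN hσ.1
      (ε := c / (4 * D)) (by positivity) hMX fun x hx => not_le.1 (hX x hx.le))
    rw [← hD, show 2 * (c / (4 * D)) * D = c / 2 by field_simp; norm_num,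
      div_eq_mul_inv, div_eq_mul_inv (c / 2)] at h
    linarith
  have hlim : Tendsto (fun σ : ℝ => c / 2 * (σ ^ (N + 1))⁻¹) (nhdsWithin 0 (Set.Ioi 0)) atTop := by
    refine Tendsto.const_mul_atTop (by positivity) ?_
    refine (tendsto_rpow_neg_nhdsGT_zero (neg_lt_zero.2 hN1)).congr' ?_
    filter_upwards [self_mem_nhdsWithin] with σ hσ
    exact Real.rpow_neg (le_of_lt hσ) _
  obtain ⟨σ, hσ, hσ'⟩ := ((hlim.eventually_gt_atTop (∫ x in Set.Ioc 1 X, ‖M x‖)).and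
    (Ioo_mem_nhdsGT hσ₀)).exists
  exact (hbound σ hσ').not_gt hσ
end

section
/- Let p₁ < p₂ < … < p_d be distinct primes, α = (log p₁, …, log p_d), and θ ∈ ℝ^d. Let x_n = nα − θ mod 1 (coordinatewise fractional parts). Then there exist constants δ > 0 and C > 0 such that for all x ≥ 1, the discrepancy satisfies D_x* := sup_{β ∈ [0,1]^d} | (1/x) · #{n ≤ x : x_n ∈ ∏_{j=1}^d [0, β_j]} − ∏_{j=1}^d β_j | ≤ C · x^{−δ}. -/
open Filter Finset
open scoped Classical

open Polynomial in
/-- The ring of complex polynomials taking integer values at natural numbers. -/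
noncomputable def integerValued : Subring ℂ[X] :=
  ⨅ s : ℕ, (Int.castRingHom ℂ).range.comap (Polynomial.evalRingHom (s : ℂ))

open Polynomial in
theorem mem_integerValued {q : ℂ[X]} :
    q ∈ integerValued ↔ ∀ s : ℕ, ∃ m : ℤ, (m : ℂ) = q.eval (s : ℂ) := by
  simp [integerValued, Subring.mem_iInf]

open Polynomial in
/-- The polynomials `q` all of whose scaled derivatives `ν ^ j * q^(j)` are integer valued. -/
noncomputable def scaledIntegerValued (ν : ℕ) : Subring ℂ[X] where
  carrier := {q | ∀ j, (ν : ℂ[X]) ^ j * derivative^[j] q ∈ integerValued}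
  mul_mem' {p q} hp hq j := by
    rw [iterate_derivative_mul, Finset.mul_sum]
    refine Subring.sum_mem _ fun k hk => ?_
    have hk : k ≤ j := by simpa [Nat.lt_succ_iff] using hk
    rw [mul_smul_comm]
    refine nsmul_mem ?_ _
    have : (ν : ℂ[X]) ^ j = (ν : ℂ[X]) ^ (j - k) * (ν : ℂ[X]) ^ k := by
      rw [← pow_add, Nat.sub_add_cancel hk]
    rw [this, mul_mul_mul_comm]
    exact mul_mem (hp _) (hq _)
  one_mem' j := by
    cases j with
    | zero => simp [one_mem]
    | succ j => simp [zero_mem]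
  add_mem' {p q} hp hq j := by
    rw [iterate_map_add, mul_add]
    exact add_mem (hp j) (hq j)
  zero_mem' j := by simp [zero_mem]
  neg_mem' {p} hp j := by
    rw [iterate_derivative_neg, mul_neg]
    exact neg_mem (hp j)

open Polynomial in
theorem mul_derivative_mem_scaledIntegerValued {ν : ℕ} {q : ℂ[X]}
    (hq : q ∈ scaledIntegerValued ν) : (ν : ℂ[X]) * derivative q ∈ scaledIntegerValued ν := by
  intro j
  have h := hq (j + 1)
  rw [← C_eq_natCast, iterate_derivative_C_mul, ← Function.iterate_succ_apply]
  rw [← C_eq_natCast, pow_succ, mul_assoc] at h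
  exact h

open Polynomial in
theorem scaledIntegerValued_le (ν : ℕ) : scaledIntegerValued ν ≤ integerValued := by
  intro q hq
  simpa using hq 0

/-- The binomial polynomial `X (X - 1) ⋯ (X - a + 1) / a!`. -/
noncomputable def binomPoly (a : ℕ) : Polynomial ℂ :=
  Polynomial.C ((a.factorial : ℂ)⁻¹) * descPochhammer ℂ a

theorem binomPoly_eval_natCast (a s : ℕ) :
    (binomPoly a).eval (s : ℂ) = (s.choose a : ℂ) := by
  rw [Nat.cast_choose_eq_descPochhammer_div, binomPoly]
  simp [div_eq_inv_mul]

theorem natDegree_binomPoly (a : ℕ) : (binomPoly a).natDegree = a := by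
  rw [binomPoly, Polynomial.natDegree_C_mul (by simp [Nat.factorial_ne_zero]),
    descPochhammer_natDegree]

theorem binomPoly_ne_zero (a : ℕ) : binomPoly a ≠ 0 := by
  rw [binomPoly]
  exact mul_ne_zero (by simp [Nat.factorial_ne_zero]) (monic_descPochhammer ℂ a).ne_zero

theorem norm_descPochhammer_eval_le (a : ℕ) (z : ℂ) :
    ‖(descPochhammer ℂ a).eval z‖ ≤ (‖z‖ + a) ^ a := by
  rw [descPochhammer_eval_eq_prod_range, norm_prod]
  calc ∏ j ∈ range a, ‖z - (j : ℂ)‖ ≤ ∏ j ∈ range a, (‖z‖ + a) := by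
        refine Finset.prod_le_prod (fun _ _ => norm_nonneg _) fun j hj => ?_
        refine (norm_sub_le _ _).trans ?_
        have : j ≤ a := (mem_range.1 hj).le
        simpa using this
    _ = _ := by simp

theorem norm_binomPoly_eval_le (a : ℕ) (z : ℂ) :
    ‖(binomPoly a).eval z‖ ≤ Real.exp (‖z‖ + a) := by
  have h := Real.pow_div_factorial_le_exp (‖z‖ + a) (by positivity) a
  refine le_trans ?_ h
  rw [binomPoly, Polynomial.eval_C_mul, norm_mul, norm_inv, Complex.norm_natCast,
    inv_mul_eq_div]
  gcongr
  exact norm_descPochhammer_eval_le a z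

theorem descPochhammer_eval_neg_one (a : ℕ) :
    (descPochhammer ℂ a).eval (-1) = (-1) ^ a * (a.factorial : ℂ) := by
  induction a with
  | zero => simp
  | succ n ih =>
    rw [descPochhammer_succ_right, Polynomial.eval_mul, ih, Nat.factorial_succ]
    simp
    ring

theorem derivative_binomPoly_succ_eval_zero (a : ℕ) :
    (Polynomial.derivative (binomPoly (a + 1))).eval 0 = (-1) ^ a / ((a : ℂ) + 1) := by
  rw [binomPoly, descPochhammer_succ_left, Nat.factorial_succ]
  have h1 : (a.factorial : ℂ) ≠ 0 := by exact_mod_cast Nat.factorial_ne_zero a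
  have h2 : (a : ℂ) + 1 ≠ 0 := by exact_mod_cast Nat.succ_ne_zero a
  simp [Polynomial.derivative_mul, Polynomial.eval_comp, descPochhammer_eval_neg_one]
  field_simp

open Polynomial in
theorem exists_eq_sum_binomPoly {h : ℕ} {q : ℂ[X]} (hd : q.natDegree ≤ h)
    (hq : q ∈ integerValued) :
    ∃ c : ℕ → ℤ, q = ∑ j ∈ range (h + 1), (c j : ℂ[X]) * binomPoly j := by
  choose v hv using mem_integerValued.1 hq
  refine ⟨fun j => (fwdDiff 1)^[j] v 0, ?_⟩
  refine Polynomial.eq_of_natDegree_lt_card_of_eval_eq (ι := Fin (h + 1)) _ _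
    (f := fun i => ((i : ℕ) : ℂ)) (fun i j hij => by simpa [Fin.ext_iff] using hij) ?_ ?_
  · intro i
    have := shift_eq_sum_fwdDiff_iter (1 : ℕ) v i 0
    rw [← hv]
    simp only [smul_eq_mul, mul_one, zero_add] at this
    rw [this, eval_finsetSum]
    have hle : range ((i : ℕ) + 1) ⊆ range (h + 1) := by
      intro x; simp; omega
    push_cast
    rw [← Finset.sum_subset hle]
    · refine Finset.sum_congr rfl fun j _ => ?_
      rw [eval_mul, binomPoly_eval_natCast]
      simp [mul_comm]
    · intro j _ hj
      rw [eval_mul, binomPoly_eval_natCast, Nat.choose_eq_zero_of_lt]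
      · simp
      · simpa using hj
  · simp only [Fintype.card_fin]
    refine max_lt (Nat.lt_succ_of_le hd) (Nat.lt_succ_of_le ?_)
    refine natDegree_sum_le_of_forall_le _ _ fun j hj => ?_
    refine (natDegree_mul_le).trans ?_
    rw [natDegree_intCast, natDegree_binomPoly]
    have := mem_range.1 hj
    omega

open Polynomial in
theorem mul_derivative_mem_integerValued {h ν : ℕ} (hν : ∀ j ∈ Finset.Icc 1 h, j ∣ ν) {q : ℂ[X]}
    (hd : q.natDegree ≤ h) (hq : q ∈ integerValued) :
    (ν : ℂ[X]) * derivative q ∈ integerValued := by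
  rw [mem_integerValued]
  intro s
  obtain ⟨c, hc⟩ := exists_eq_sum_binomPoly (h := h) (q := q.comp (X + (s : ℂ[X])))
    (by rwa [natDegree_comp, ← C_eq_natCast, natDegree_X_add_C, mul_one]) (by
      rw [mem_integerValued] at hq ⊢
      intro n
      obtain ⟨m, hm⟩ := hq (n + s)
      exact ⟨m, by simpa [eval_comp] using hm⟩)
  have hder := congrArg (fun p => eval 0 (derivative p)) hc
  simp only [derivative_comp, derivative_sum, eval_finsetSum] at hder
  simp only [derivative_mul, derivative_intCast, derivative_add, derivative_X, derivative_natCast,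
    eval_mul, eval_comp, eval_add, eval_X, eval_natCast, zero_mul, zero_add, add_zero,
    one_mul, eval_intCast] at hder
  have hmem : (ν : ℂ) * eval (s : ℂ) (derivative q) ∈ (Int.castRingHom ℂ).range := by
    rw [hder, Finset.mul_sum]
    refine Subring.sum_mem _ fun j hj => ?_
    cases j with
    | zero => simp [binomPoly, zero_mem]
    | succ j =>
      obtain ⟨w, hw⟩ := hν (j + 1) (by simp at hj ⊢; omega)
      rw [derivative_binomPoly_succ_eval_zero, hw]
      refine ⟨w * c (j + 1) * (-1) ^ j, ?_⟩
      have h2 : (j : ℂ) + 1 ≠ 0 := by exact_mod_cast Nat.succ_ne_zero j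
      simp
      field_simp
  simpa using hmem

theorem binomPoly_mem_scaledIntegerValued {h ν a : ℕ} (hν : ∀ j ∈ Finset.Icc 1 h, j ∣ ν)
    (ha : a ≤ h) : binomPoly a ∈ scaledIntegerValued ν := by
  intro j
  induction j with
  | zero =>
    simp only [pow_zero, Function.iterate_zero, id_eq, one_mul]
    exact mem_integerValued.2 fun s => ⟨s.choose a, by rw [binomPoly_eval_natCast]; simp⟩
  | succ j ih =>
    have := mul_derivative_mem_integerValued hν ?_ ih
    · rw [← Polynomial.C_eq_natCast, ← map_pow, Polynomial.derivative_C_mul,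
        ← Function.iterate_succ_apply' (f := Polynomial.derivative), ← mul_assoc,
        map_pow, ← pow_succ'] at this
      exact this
    · rw [← Polynomial.C_eq_natCast, ← map_pow]
      refine (Polynomial.natDegree_C_mul_le _ _).trans ?_
      refine (Polynomial.natDegree_iterate_derivative _ _).trans ?_
      rw [natDegree_binomPoly]
      omega

/-- A polynomial of degree `r` that is a product of binomial polynomials of degree at most `h`. -/
noncomputable def binomProd (h r : ℕ) : Polynomial ℂ :=
  binomPoly h ^ (r / h) * binomPoly (r % h)

theorem natDegree_binomProd (h r : ℕ) : (binomProd h r).natDegree = r := by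
  rw [binomProd, Polynomial.natDegree_mul (pow_ne_zero _ (binomPoly_ne_zero _))
    (binomPoly_ne_zero _), Polynomial.natDegree_pow, natDegree_binomPoly, natDegree_binomPoly,
    mul_comm, Nat.div_add_mod]

theorem binomProd_ne_zero (h r : ℕ) : binomProd h r ≠ 0 :=
  mul_ne_zero (pow_ne_zero _ (binomPoly_ne_zero _)) (binomPoly_ne_zero _)

theorem binomProd_mem_scaledIntegerValued {h ν : ℕ} (hh : 0 < h)
    (hν : ∀ j ∈ Finset.Icc 1 h, j ∣ ν) (r : ℕ) : binomProd h r ∈ scaledIntegerValued ν :=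
  mul_mem (pow_mem (binomPoly_mem_scaledIntegerValued hν le_rfl) _)
    (binomPoly_mem_scaledIntegerValued hν (Nat.mod_lt _ hh).le)

theorem norm_binomProd_eval_le {h M r : ℕ} (hr : r < h * M) (z : ℂ) :
    ‖(binomProd h r).eval z‖ ≤ Real.exp (M * (‖z‖ + h)) := by
  have hh : 0 < h := Nat.pos_of_ne_zero fun h0 => by simp [h0] at hr
  have hM : r / h + 1 ≤ M := Nat.div_lt_of_lt_mul hr
  rw [binomProd, Polynomial.eval_mul, Polynomial.eval_pow, norm_mul, norm_pow]
  calc _ ≤ Real.exp (‖z‖ + h) ^ (r / h) * Real.exp (‖z‖ + h) := by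
        gcongr
        · exact norm_binomPoly_eval_le _ _
        · refine (norm_binomPoly_eval_le _ _).trans ?_
          have := (Nat.mod_lt r hh).le
          gcongr
    _ = Real.exp (((r / h + 1 : ℕ) : ℝ) * (‖z‖ + h)) := by
        rw [← pow_succ, ← Real.exp_nat_mul]
    _ ≤ _ := by gcongr

theorem linearIndependent_binomProd (h : ℕ) :
    LinearIndependent ℂ (fun r : ℕ => binomProd h r) :=
  Polynomial.Sequence.linearIndependent
    { elems' := binomProd h
      degree_eq' := fun r => by
        rw [Polynomial.degree_eq_natDegree (binomProd_ne_zero h r), natDegree_binomProd] }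

open Polynomial in
theorem eq_zero_of_sum_eval_mul_pow_eq_zero {ι : Type*} (Ω : Finset ι) (x : ι → ℂ)
    (hx : Set.InjOn x Ω) (hx0 : ∀ i ∈ Ω, x i ≠ 0) (P : ι → ℂ[X]) (D : ι → ℕ)
    (hD : ∀ i ∈ Ω, (P i).degree < (D i : WithBot ℕ))
    (hP : ∀ s < ∑ i ∈ Ω, D i, ∑ i ∈ Ω, (P i).eval (s : ℂ) * x i ^ s = 0) :
    ∀ i ∈ Ω, P i = 0 := by
  generalize hN : ∑ i ∈ Ω, D i = N at hP
  induction N generalizing P D with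
  | zero =>
    intro i hi
    have := hD i hi
    rw [Finset.sum_eq_zero_iff] at hN
    rw [hN i hi] at this
    exact degree_eq_bot.1 (Nat.WithBot.lt_zero_iff.1 (by simpa using this))
  | succ N ih =>
    obtain ⟨k, hk, hk0⟩ : ∃ k ∈ Ω, D k ≠ 0 := by
      by_contra! h
      rw [Finset.sum_eq_zero h] at hN
      omega
    have hPk := hD k hk
    have key := ih (fun i => C (x i) * taylor 1 (P i) - C (x k) * P i)
      (Function.update D k (D k - 1)) ?_ ?_ ?_
    · have hne : ∀ i ∈ Ω, i ≠ k → P i = 0 := by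
        intro i hi hik
        have h0 := key i hi
        have hc := congrArg (fun q => q.coeff (P i).natDegree) h0
        simp only [coeff_sub, coeff_C_mul, coeff_taylor_natDegree, coeff_zero, coeff_natDegree,
          ← sub_mul] at hc
        rcases mul_eq_zero.1 hc with h | h
        · exact absurd (hx hi hk (sub_eq_zero.1 h)) hik
        · exact leadingCoeff_eq_zero.1 h
      intro i hi
      by_cases hik : i = k
      swap
      · exact hne i hi hik
      subst hik
      have h0 := hP 0 (by omega)
      rw [Finset.sum_eq_single_of_mem i hi] at h0
      swap
      · intro j hj hji
        simp [hne j hj hji]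
      have h0 : (P i).eval 0 = 0 := by simpa using h0
      have h1 := key i hi
      have h2 : taylor 1 (P i) = P i := by
        rw [← mul_sub, mul_eq_zero, C_eq_zero, sub_eq_zero] at h1
        exact h1.resolve_left (hx0 i hi)
      have h3 : ∀ n : ℕ, (P i).eval (n : ℂ) = 0 := by
        intro n
        induction n with
        | zero => simpa using h0
        | succ n ihn =>
          rw [← h2, taylor_eval] at ihn
          exact_mod_cast ihn
      refine Polynomial.eq_zero_of_infinite_isRoot _ ?_
      refine (Set.infinite_range_of_injective (Nat.cast_injective (R := ℂ))).mono ?_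
      rintro _ ⟨n, rfl⟩
      exact h3 n
    · intro i hi
      by_cases hik : i = k
      · subst hik
        simp only [Function.update_self]
        rw [← mul_sub]
        by_cases hPi : P i = 0
        · simp [hPi]
        have h1 : (taylor 1 (P i) - P i).degree < (P i).degree := by
          rw [← degree_taylor (P i) 1]
          refine degree_sub_lt_left (by simp) (by simpa using hPi) (by simp)
        rw [degree_C_mul (hx0 i hi)]
        refine h1.trans_le ?_
        rw [degree_eq_natDegree hPi] at hPk ⊢
        norm_cast at hPk ⊢
        omega
      · simp only [Function.update_of_ne hik]
        refine (degree_sub_le _ _).trans_lt (max_lt ?_ ?_)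
        · rw [degree_C_mul (hx0 i hi), degree_taylor]
          exact hD i hi
        · rw [degree_C_mul (hx0 k hk)]
          exact hD i hi
    · rw [Finset.sum_update_of_mem hk]
      rw [← Finset.add_sum_erase _ _ hk, ← Finset.sdiff_singleton_eq_erase] at hN
      omega
    · intro s hs
      have h1 := hP (s + 1) (by omega)
      have h2 := hP s (by omega)
      have : ∑ i ∈ Ω, eval (s : ℂ) (C (x i) * taylor 1 (P i) - C (x k) * P i) * x i ^ s
          = ∑ i ∈ Ω, (P i).eval (((s + 1 : ℕ)) : ℂ) * x i ^ (s + 1)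
            - x k * ∑ i ∈ Ω, (P i).eval (s : ℂ) * x i ^ s := by
        rw [Finset.mul_sum, ← Finset.sum_sub_distrib]
        refine Finset.sum_congr rfl fun i _ => ?_
        simp only [eval_sub, eval_mul, eval_C, taylor_eval]
        push_cast
        ring
      rw [this, h1, h2]
      simp

theorem prod_pow_injective {d : ℕ} {p : Fin d → ℕ} (hp : ∀ i, (p i).Prime)
    (hinj : Function.Injective p) :
    Function.Injective (fun l : Fin d → ℕ => ∏ i, p i ^ l i) := by
  have key : ∀ (l : Fin d → ℕ) (i : Fin d), (∏ j, p j ^ l j).factorization (p i) = l i := by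
    intro l i
    rw [Nat.factorization_prod (fun j _ => pow_ne_zero _ (hp j).ne_zero)]
    simp only [Finset.sum_apply', Nat.factorization_pow]
    rw [Finset.sum_eq_single i]
    · simp [(hp i).factorization]
    · intro j _ hji
      have : p j ≠ p i := fun h => hji (hinj h)
      simp [(hp j).factorization, this]
    · simp
  intro l l' h
  funext i
  rw [← key l i, ← key l' i]
  exact congrArg (fun n => n.factorization (p i)) h

theorem Complex.norm_sin_le_exp_norm (z : ℂ) : ‖Complex.sin z‖ ≤ Real.exp ‖z‖ := by
  have h1 := Complex.norm_exp_le_exp_norm (-z * Complex.I)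
  have h2 := Complex.norm_exp_le_exp_norm (z * Complex.I)
  simp only [norm_mul, norm_neg, Complex.norm_I, mul_one] at h1 h2
  rw [Complex.sin]
  simp only [norm_div, norm_mul, Complex.norm_I, mul_one, Complex.norm_ofNat]
  have := norm_sub_le (Complex.exp (-z * Complex.I)) (Complex.exp (z * Complex.I))
  linarith

theorem Complex.norm_cos_le_exp_norm (z : ℂ) : ‖Complex.cos z‖ ≤ Real.exp ‖z‖ := by
  have h1 := Complex.norm_exp_le_exp_norm (-z * Complex.I)
  have h2 := Complex.norm_exp_le_exp_norm (z * Complex.I)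
  simp only [norm_mul, norm_neg, Complex.norm_I, mul_one] at h1 h2
  rw [Complex.cos]
  simp only [norm_div, Complex.norm_ofNat]
  have := norm_add_le (Complex.exp (z * Complex.I)) (Complex.exp (-z * Complex.I))
  linarith

theorem exists_primitive_sin_pow (m : ℕ) :
    ∃ (U : ℂ → ℂ) (c : ℂ) (K : ℝ), c ≠ 0 ∧ 0 < K ∧
      (∀ z, HasDerivAt U (Complex.sin (Real.pi * z) ^ (2 * m)) z) ∧
      (∀ s : ℕ, U s = c * s) ∧ ∀ z, ‖U z‖ ≤ K * Real.exp (K * ‖z‖) := by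
  induction m with
  | zero =>
    refine ⟨fun z => z, 1, 1, one_ne_zero, one_pos, fun z => by simpa using hasDerivAt_id' z,
      fun s => by simp, fun z => ?_⟩
    have := Real.add_one_le_exp ‖z‖
    simp only [one_mul]
    linarith
  | succ m ih =>
    obtain ⟨U, c, K, hc, hK, hU, hUs, hb⟩ := ih
    have hpi : (Real.pi : ℂ) ≠ 0 := by exact_mod_cast Real.pi_ne_zero
    have hm : ((2 * m + 2 : ℕ) : ℂ) ≠ 0 := by
      exact_mod_cast (Nat.succ_ne_zero (2 * m + 1))
    have hm' : ((2 * m + 1 : ℕ) : ℂ) ≠ 0 := by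
      exact_mod_cast (Nat.succ_ne_zero (2 * m))
    refine ⟨fun z => (((2 * m + 1 : ℕ) : ℂ) * U z -
        Complex.cos (Real.pi * z) * Complex.sin (Real.pi * z) ^ (2 * m + 1) / Real.pi)
          / ((2 * m + 2 : ℕ) : ℂ),
      ((2 * m + 1 : ℕ) : ℂ) * c / ((2 * m + 2 : ℕ) : ℂ),
      (2 * m + 1) * K + 1 + (2 * m + 2) * Real.pi, ?_, by positivity, ?_, ?_, ?_⟩
    · exact div_ne_zero (mul_ne_zero hm' hc) hm
    · intro z
      have h1 : HasDerivAt (fun z : ℂ => (Real.pi : ℂ) * z) Real.pi z := by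
        simpa using (hasDerivAt_id z).const_mul (Real.pi : ℂ)
      have h2 := ((h1.ccos.mul (h1.csin.pow (2 * m + 1))).div_const (Real.pi : ℂ))
      have h3 := (((hU z).const_mul (((2 * m + 1 : ℕ) : ℂ))).sub h2).div_const
        (((2 * m + 2 : ℕ) : ℂ))
      refine h3.congr_deriv ?_
      have hcs : Complex.cos (Real.pi * z) ^ 2 = 1 - Complex.sin (Real.pi * z) ^ 2 := by
        rw [← Complex.sin_sq_add_cos_sq (Real.pi * z)]; ring
      rw [div_eq_iff hm]
      simp only [Nat.add_sub_cancel, Pi.pow_apply]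
      field_simp
      rw [hcs]
      push_cast
      ring
    · intro s
      have : Complex.sin (Real.pi * s) = 0 := by
        rw [mul_comm]; exact Complex.sin_nat_mul_pi s
      simp only [this, hUs]
      field_simp
      simp
    · intro z
      have hz := norm_nonneg z
      have hpi0 := Real.pi_pos
      have hpi1 : 1 ≤ Real.pi := by linarith [Real.pi_gt_three]
      have hm2 : (1 : ℝ) ≤ 2 * m + 2 := by
        have : (0 : ℝ) ≤ m := Nat.cast_nonneg m
        linarith
      set K' : ℝ := (2 * m + 1) * K + 1 + (2 * m + 2) * Real.pi with hK'
      have hpz : ‖(Real.pi : ℂ) * z‖ = Real.pi * ‖z‖ := by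
        rw [norm_mul, Complex.norm_real, Real.norm_of_nonneg hpi0.le]
      have hcos := Complex.norm_cos_le_exp_norm (Real.pi * z)
      have hsin := Complex.norm_sin_le_exp_norm (Real.pi * z)
      rw [hpz] at hcos hsin
      have hb1 : ‖U z‖ ≤ K * Real.exp (K' * ‖z‖) := by
        refine (hb z).trans ?_
        gcongr
        rw [hK']
        have h0 : (0 : ℝ) ≤ m * K := by positivity
        have h1 : (0 : ℝ) ≤ (2 * m + 2) * Real.pi := by positivity
        nlinarith
      have hb2 : ‖Complex.cos (Real.pi * z) * Complex.sin (Real.pi * z) ^ (2 * m + 1) / Real.pi‖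
          ≤ Real.exp (K' * ‖z‖) := by
        rw [norm_div, norm_mul, norm_pow, Complex.norm_real, Real.norm_of_nonneg hpi0.le]
        refine (div_le_self (by positivity) hpi1).trans ?_
        calc _ ≤ Real.exp (Real.pi * ‖z‖) * Real.exp (Real.pi * ‖z‖) ^ (2 * m + 1) := by gcongr
          _ = Real.exp (((2 * m + 2 : ℕ) : ℝ) * (Real.pi * ‖z‖)) := by
              rw [← pow_succ', ← Real.exp_nat_mul]
          _ ≤ _ := by
              rw [Real.exp_le_exp, ← mul_assoc, hK']
              gcongr
              push_cast
              have h0 : (0 : ℝ) ≤ (2 * m + 1) * K := by positivity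
              linarith
      rw [norm_div, Complex.norm_natCast]
      refine (div_le_self (norm_nonneg _) (by push_cast; exact hm2)).trans ?_
      refine (norm_sub_le _ _).trans ?_
      rw [norm_mul, Complex.norm_natCast]
      push_cast
      calc _ ≤ (2 * m + 1) * (K * Real.exp (K' * ‖z‖)) + Real.exp (K' * ‖z‖) := by gcongr
        _ = ((2 * m + 1) * K + 1) * Real.exp (K' * ‖z‖) := by ring
        _ ≤ _ := by
          gcongr
          rw [hK']
          have h1 : (0 : ℝ) ≤ (2 * m + 2) * Real.pi := by positivity
          linarith

/-- An entire function that agrees with the identity at the natural numbers and whose derivative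
vanishes there to high order. -/
theorem exists_flat_interpolation (T : ℕ) :
    ∃ (u v : ℂ → ℂ) (K : ℝ), 1 ≤ K ∧ (∀ z, HasDerivAt u (v z) z) ∧ Differentiable ℂ v ∧
      (∀ s : ℕ, (T : ℕ∞) ≤ analyticOrderAt v (s : ℂ)) ∧
      (∀ s : ℕ, u s = s) ∧ ∀ z, ‖u z‖ ≤ K * Real.exp (K * ‖z‖) := by
  obtain ⟨U, c, K, hc, hK, hU, hUs, hb⟩ := exists_primitive_sin_pow T
  have hdiff : Differentiable ℂ (fun z : ℂ => Complex.sin (Real.pi * z)) := by fun_prop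
  refine ⟨fun z => U z / c, fun z => Complex.sin (Real.pi * z) ^ (2 * T) / c,
    max 1 (max K (K / ‖c‖)), le_max_left _ _, fun z => (hU z).div_const c, by fun_prop, ?_,
    fun s => by simp only [hUs]; field_simp, ?_⟩
  · intro s
    have h1 : (1 : ℕ∞) ≤ analyticOrderAt (fun z : ℂ => Complex.sin (Real.pi * z)) (s : ℂ) := by
      rw [Order.one_le_iff_ne_zero, (hdiff.analyticAt _).analyticOrderAt_ne_zero, mul_comm]
      exact Complex.sin_nat_mul_pi s
    have h2 : (fun z : ℂ => Complex.sin (Real.pi * z) ^ (2 * T) / c) =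
        (fun z : ℂ => Complex.sin (Real.pi * z)) ^ (2 * T) * fun _ => c⁻¹ := by
      ext z; simp [div_eq_mul_inv]
    rw [h2, analyticOrderAt_mul ((hdiff.analyticAt _).pow _) analyticAt_const,
      analyticOrderAt_pow (hdiff.analyticAt _)]
    refine le_trans ?_ le_self_add
    calc (T : ℕ∞) ≤ ((2 * T : ℕ) : ℕ∞) := by norm_cast; omega
      _ = (2 * T : ℕ) • (1 : ℕ∞) := by simp
      _ ≤ _ := nsmul_le_nsmul_right h1 _
  · intro z
    rw [norm_div]
    have hc' : 0 < ‖c‖ := norm_pos_iff.2 hc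
    calc ‖U z‖ / ‖c‖ ≤ K * Real.exp (K * ‖z‖) / ‖c‖ := by gcongr; exact hb z
      _ = K / ‖c‖ * Real.exp (K * ‖z‖) := by ring
      _ ≤ _ := by
        gcongr
        · exact (le_max_right _ _).trans (le_max_right _ _)
        · exact (le_max_left _ _).trans (le_max_right _ _)

theorem le_analyticOrderAt_sum {ι : Type*} (s : Finset ι) (f : ι → ℂ → ℂ) (z : ℂ) (n : ℕ∞)
    (hf : ∀ i ∈ s, n ≤ analyticOrderAt (f i) z) :
    n ≤ analyticOrderAt (fun w => ∑ i ∈ s, f i w) z := by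
  induction s using Finset.induction_on with
  | empty =>
    simp only [Finset.sum_empty]
    rw [analyticOrderAt_eq_top.2 (Eventually.of_forall fun _ => rfl)]
    exact le_top
  | insert a s ha ih =>
    simp only [Finset.sum_insert ha]
    exact (le_min (hf a (mem_insert_self _ _))
      (ih fun i hi => hf i (mem_insert_of_mem hi))).trans (le_analyticOrderAt_add)

theorem le_analyticOrderAt_of_hasDerivAt {d T : ℕ} (H G : (Fin d → ℕ) → ℂ → ℂ) (v : ℂ → ℂ)
    (a : Fin d → ℂ) (z₀ : ℂ) (hv : (T : ℕ∞) ≤ analyticOrderAt v z₀) (hvd : Differentiable ℂ v)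
    (hG : ∀ t, Differentiable ℂ (G t))
    (hH : ∀ t z, HasDerivAt (H t) (∑ i, a i * H (t + Pi.single i 1) z + v z * G t z) z)
    (h0 : ∀ t, ∑ i, t i < T → H t z₀ = 0) (m : ℕ) (t : Fin d → ℕ) (ht : ∑ i, t i + m ≤ T) :
    (m : ℕ∞) ≤ analyticOrderAt (H t) z₀ := by
  have hd : ∀ t, Differentiable ℂ (H t) := fun t z => (hH t z).differentiableAt
  induction m generalizing t with
  | zero => simp
  | succ m ih =>
    rw [Nat.cast_add, Nat.cast_one, ← analyticOrderAt_deriv_ge_iff ((hd t).analyticAt _)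
      (h0 t (by omega))]
    have h1 : deriv (H t) = (fun z => ∑ i, a i * H (t + Pi.single i 1) z) +
        fun z => v z * G t z := by
      ext z; exact (hH t z).deriv
    rw [h1]
    refine (le_min ?_ ?_).trans le_analyticOrderAt_add
    · refine le_analyticOrderAt_sum _ _ _ _ fun i _ => ?_
      have h2 : (fun w => a i * H (t + Pi.single i 1) w) =
        (fun _ => a i) * H (t + Pi.single i 1) := rfl
      rw [h2, analyticOrderAt_mul analyticAt_const ((hd _).analyticAt _)]
      refine (ih _ ?_).trans le_add_self
      simp only [Pi.add_apply, Finset.sum_add_distrib, Finset.sum_pi_single', mem_univ, if_true]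
      omega
    · have h2 : (fun z => v z * G t z) = v * G t := rfl
      rw [h2, analyticOrderAt_mul (hvd.analyticAt _) ((hG _).analyticAt _)]
      refine le_trans ?_ le_self_add
      refine le_trans ?_ hv
      norm_cast
      omega

theorem exists_eq_sub_pow_mul {f : ℂ → ℂ} (hf : Differentiable ℂ f) (a : ℂ) (n : ℕ)
    (hn : (n : ℕ∞) ≤ analyticOrderAt f a) :
    ∃ g : ℂ → ℂ, Differentiable ℂ g ∧ ∀ z, f z = (z - a) ^ n * g z := by
  induction n generalizing f with
  | zero => exact ⟨f, hf, fun z => by simp⟩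
  | succ n ih =>
    have hfa : f a = 0 := apply_eq_zero_of_analyticOrderAt_ne_zero (z₀ := a) (by
      rw [← Order.one_le_iff_ne_zero]
      refine le_trans ?_ hn
      norm_cast
      omega)
    have hg : Differentiable ℂ (dslope f a) := by
      rw [← differentiableOn_univ] at hf ⊢
      exact (Complex.differentiableOn_dslope Filter.univ_mem).2 hf
    have hfg : ∀ z, f z = (z - a) * dslope f a z := fun z => by
      have := sub_smul_dslope f a z
      rw [hfa, sub_zero, smul_eq_mul] at this
      exact this.symm
    have hfg' : f = (· - a) * dslope f a := funext hfg
    have hsub : Differentiable ℂ (fun z : ℂ => z - a) := by fun_prop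
    rw [hfg', analyticOrderAt_mul (hsub.analyticAt _) (hg.analyticAt _),
      show analyticOrderAt (fun z : ℂ => z - a) a = 1 by simp] at hn
    obtain ⟨g, hgd, hgz⟩ := ih hg (by
      rw [Nat.cast_add, Nat.cast_one, add_comm] at hn
      exact (ENat.add_le_add_iff_left ENat.one_ne_top).1 hn)
    exact ⟨g, hgd, fun z => by rw [hfg, hgz]; ring⟩

theorem exists_eq_prod_sub_pow_mul {f : ℂ → ℂ} (hf : Differentiable ℂ f) (S n : ℕ)
    (hn : ∀ s < S, (n : ℕ∞) ≤ analyticOrderAt f (s : ℂ)) :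
    ∃ g : ℂ → ℂ, Differentiable ℂ g ∧ ∀ z, f z = (∏ s ∈ range S, (z - s) ^ n) * g z := by
  induction S with
  | zero => exact ⟨f, hf, fun z => by simp⟩
  | succ S ih =>
    obtain ⟨g, hg, hfg⟩ := ih fun s hs => hn s (by omega)
    have hP : Differentiable ℂ (fun z : ℂ => ∏ s ∈ range S, (z - s) ^ n) := by fun_prop
    have hP0 : analyticOrderAt (fun z : ℂ => ∏ s ∈ range S, (z - s) ^ n) (S : ℂ) = 0 := by
      rw [(hP.analyticAt _).analyticOrderAt_eq_zero]
      refine Finset.prod_ne_zero_iff.2 fun s hs => pow_ne_zero _ (sub_ne_zero.2 ?_)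
      have := mem_range.1 hs
      exact_mod_cast this.ne'
    have h1 := hn S (by omega)
    have h2 : f = (fun z : ℂ => ∏ s ∈ range S, (z - s) ^ n) * g := funext hfg
    rw [h2, analyticOrderAt_mul (hP.analyticAt _) (hg.analyticAt _), hP0, zero_add] at h1
    obtain ⟨g', hg', hgg'⟩ := exists_eq_sub_pow_mul hg _ _ h1
    refine ⟨g', hg', fun z => ?_⟩
    rw [hfg, hgg', Finset.prod_range_succ]
    ring

/-- Schwarz lemma for an entire function with zeros of multiplicity `n` at `0, …, S - 1`. -/
theorem norm_le_of_analyticOrderAt {f : ℂ → ℂ} (hf : Differentiable ℂ f) {S n : ℕ}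
    (hn : ∀ s < S, (n : ℕ∞) ≤ analyticOrderAt f (s : ℂ)) {r R A : ℝ} (hS : (S : ℝ) ≤ r)
    (hrR : r < R) (hA : ∀ z, ‖z‖ = R → ‖f z‖ ≤ A) {w : ℂ} (hw : ‖w‖ ≤ r) :
    ‖f w‖ ≤ A * (2 * r / (R - r)) ^ (S * n) := by
  obtain ⟨g, hg, hfg⟩ := exists_eq_prod_sub_pow_mul hf S n hn
  have hr0 : 0 ≤ r := (norm_nonneg w).trans hw
  have hRr : 0 < R - r := sub_pos.2 hrR
  have hR0 : R ≠ 0 := (hr0.trans_lt hrR).ne'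
  have hA0 : 0 ≤ A := (norm_nonneg _).trans (hA (R : ℂ) (by
    rw [Complex.norm_real, Real.norm_of_nonneg (hr0.trans hrR.le)]))
  have hsr : ∀ s ∈ range S, (s : ℝ) ≤ r := fun s hs => by
    have := (mem_range.1 hs).le
    exact le_trans (by exact_mod_cast this) hS
  have hgw : ‖g w‖ ≤ A / (R - r) ^ (S * n) := by
    refine Complex.norm_le_of_forall_mem_frontier_norm_le (U := Metric.ball (0 : ℂ) R)
      Metric.isBounded_ball hg.diffContOnCl ?_ ?_
    · intro z hz
      rw [frontier_ball _ hR0, mem_sphere_zero_iff_norm] at hz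
      rw [le_div_iff₀ (by positivity)]
      refine le_trans ?_ (hA z hz)
      rw [hfg z, norm_mul, mul_comm, norm_prod, pow_mul']
      gcongr
      calc ((R - r) ^ n) ^ S = ∏ s ∈ range S, (R - r) ^ n := by simp
        _ ≤ _ := by
          refine Finset.prod_le_prod (fun _ _ => by positivity) fun s hs => ?_
          rw [norm_pow]
          gcongr
          have := norm_sub_norm_le z (s : ℂ)
          rw [hz, Complex.norm_natCast] at this
          linarith [hsr s hs]
    · rw [closure_ball _ hR0, mem_closedBall_zero_iff]
      linarith
  rw [hfg w, norm_mul, norm_prod, div_pow, mul_div_assoc', mul_comm A, mul_div_assoc]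
  have hprod : ∏ s ∈ range S, ‖(w - (s : ℂ)) ^ n‖ ≤ (2 * r) ^ (S * n) := by
    rw [pow_mul']
    calc _ ≤ ∏ s ∈ range S, (2 * r) ^ n := by
          refine Finset.prod_le_prod (fun _ _ => norm_nonneg _) fun s hs => ?_
          rw [norm_pow]
          gcongr
          refine (norm_sub_le _ _).trans ?_
          rw [Complex.norm_natCast]
          linarith [hsr s hs]
      _ = _ := by simp
  gcongr

theorem norm_deriv_le_of_forall_norm_le {f : ℂ → ℂ} (hf : Differentiable ℂ f) {R A : ℝ}
    (hA : ∀ z, ‖z‖ ≤ R + 1 → ‖f z‖ ≤ A) {z : ℂ} (hz : ‖z‖ ≤ R) : ‖deriv f z‖ ≤ A := by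
  have := Complex.norm_deriv_le_of_forall_mem_sphere_norm_le (c := z) (f := f) one_pos
    hf.diffContOnCl (C := A) fun w hw => hA w (by
      rw [mem_sphere_iff_norm] at hw
      have := norm_le_norm_add_norm_sub' w z
      rw [norm_sub_rev] at this
      rw [norm_sub_rev] at hw
      linarith)
  simpa using this

open Polynomial in
/-- The action of the derivation `b_k ∂_0 - b_0 ∂_k` on the coefficient `q` of a function
`q(z_0) exp(m z_k)`. -/
noncomputable def twistedDerivative (b₀ bk : ℤ) (m : ℕ) (q : ℂ[X]) : ℂ[X] :=
  (bk : ℂ[X]) * derivative q - ((b₀ * m : ℤ) : ℂ[X]) * q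

open Polynomial in
/-- The coefficient of the function obtained from `q(z_0) exp(∑ l_i z_i)` by applying the
derivations `b_k ∂_i - b_i ∂_k` (`i ≠ k`) and `b_k ∂_0 - b_0 ∂_k` with multiplicities `t_i` and
`t_k`. -/
noncomputable def iteratedTwist {d : ℕ} (b₀ : ℤ) (b : Fin d → ℤ) (k : Fin d) (l t : Fin d → ℕ)
    (q : ℂ[X]) : ℂ[X] :=
  ((∏ i ∈ univ.erase k, (b k * l i - b i * l k) ^ t i : ℤ) : ℂ[X]) *
    (twistedDerivative b₀ (b k) (l k))^[t k] q

section Twist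

open Polynomial

variable {d : ℕ} (b₀ : ℤ) (b : Fin d → ℤ) (k : Fin d) (l t : Fin d → ℕ) (q : ℂ[X])

theorem iteratedTwist_zero : iteratedTwist b₀ b k l 0 q = q := by
  simp [iteratedTwist]

theorem iteratedTwist_add_single_self :
    iteratedTwist b₀ b k l (t + Pi.single k 1) q =
      twistedDerivative b₀ (b k) (l k) (iteratedTwist b₀ b k l t q) := by
  have h1 : ∏ i ∈ univ.erase k, (b k * l i - b i * l k) ^ (t + Pi.single k 1 : Fin d → ℕ) i =
      ∏ i ∈ univ.erase k, (b k * l i - b i * l k) ^ t i := by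
    refine Finset.prod_congr rfl fun i hi => ?_
    simp [Pi.single_eq_of_ne (Finset.ne_of_mem_erase hi)]
  rw [iteratedTwist, h1, iteratedTwist]
  simp only [Pi.add_apply, Pi.single_eq_same, Function.iterate_succ_apply', twistedDerivative,
    derivative_mul, derivative_intCast]
  ring

theorem iteratedTwist_add_single_of_ne {i : Fin d} (hi : i ≠ k) :
    iteratedTwist b₀ b k l (t + Pi.single i 1) q =
      ((b k * l i - b i * l k : ℤ) : ℂ[X]) * iteratedTwist b₀ b k l t q := by
  have h1 : ∏ j ∈ univ.erase k, (b k * l j - b j * l k) ^ (t + Pi.single i 1 : Fin d → ℕ) j =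
      (b k * l i - b i * l k) * ∏ j ∈ univ.erase k, (b k * l j - b j * l k) ^ t j := by
    have hmem : i ∈ univ.erase k := Finset.mem_erase.2 ⟨hi, mem_univ _⟩
    rw [← Finset.mul_prod_erase _ _ hmem, ← Finset.mul_prod_erase _ _ hmem]
    simp only [Pi.add_apply, Pi.single_eq_same, pow_succ]
    rw [Finset.prod_congr rfl fun j hj => by
      rw [Pi.single_eq_of_ne (Finset.ne_of_mem_erase hj), add_zero]]
    ring
  rw [iteratedTwist, h1, iteratedTwist]
  simp only [Pi.add_apply, Pi.single_eq_of_ne hi.symm, add_zero]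
  push_cast
  ring

theorem mul_iteratedTwist_mem_scaledIntegerValued {ν : ℕ} (hq : q ∈ scaledIntegerValued ν) :
    (ν : ℂ[X]) ^ (∑ i, t i) * iteratedTwist b₀ b k l t q ∈ scaledIntegerValued ν := by
  have h1 : ∀ n : ℕ, (ν : ℂ[X]) ^ n * (twistedDerivative b₀ (b k) (l k))^[n] q ∈
      scaledIntegerValued ν := by
    intro n
    induction n with
    | zero => simpa using hq
    | succ n ih =>
      rw [Function.iterate_succ_apply']
      have h2 := mul_derivative_mem_scaledIntegerValued ih
      have h3 : (ν : ℂ[X]) ^ (n + 1) * twistedDerivative b₀ (b k) (l k)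
          ((twistedDerivative b₀ (b k) (l k))^[n] q) =
          (b k : ℂ[X]) * ((ν : ℂ[X]) * derivative ((ν : ℂ[X]) ^ n *
            (twistedDerivative b₀ (b k) (l k))^[n] q)) -
          ((ν * (b₀ * l k) : ℤ) : ℂ[X]) * ((ν : ℂ[X]) ^ n *
            (twistedDerivative b₀ (b k) (l k))^[n] q) := by
        have h4 : derivative ((ν : ℂ[X]) ^ n) = 0 := by
          rw [← Nat.cast_pow, derivative_natCast]
        rw [twistedDerivative, derivative_mul, h4]
        push_cast
        ring
      rw [h3]
      exact sub_mem (mul_mem (intCast_mem _ _) h2) (mul_mem (intCast_mem _ _) ih)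
  rw [← Finset.add_sum_erase _ _ (mem_univ k), iteratedTwist, pow_add]
  have h4 : (ν : ℂ[X]) ^ t k * (ν : ℂ[X]) ^ (∑ i ∈ univ.erase k, t i) *
      (((∏ i ∈ univ.erase k, (b k * l i - b i * l k) ^ t i : ℤ) : ℂ[X]) *
        (twistedDerivative b₀ (b k) (l k))^[t k] q) =
      ((ν ^ (∑ i ∈ univ.erase k, t i) *
        ∏ i ∈ univ.erase k, (b k * l i - b i * l k) ^ t i : ℤ) : ℂ[X]) *
        ((ν : ℂ[X]) ^ t k * (twistedDerivative b₀ (b k) (l k))^[t k] q) := by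
    push_cast
    ring
  rw [h4]
  exact mul_mem (intCast_mem _ _) (h1 _)

theorem norm_iteratedTwist_eval_le {B L : ℝ} (hL : 1 ≤ L) (hb₀ : |(b₀ : ℝ)| ≤ B)
    (hb : ∀ i, |(b i : ℝ)| ≤ B) (hl : ∀ i, (l i : ℝ) ≤ L) {R G : ℝ}
    (hq : ∀ z : ℂ, ‖z‖ ≤ R + t k → ‖q.eval z‖ ≤ G) {z : ℂ} (hz : ‖z‖ ≤ R) :
    ‖(iteratedTwist b₀ b k l t q).eval z‖ ≤ (2 * B * L) ^ (∑ i, t i) * G := by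
  have hB : 0 ≤ B := (abs_nonneg _).trans hb₀
  have h1 : ∀ (n : ℕ) (R : ℝ), (∀ z : ℂ, ‖z‖ ≤ R + n → ‖q.eval z‖ ≤ G) → ∀ z : ℂ, ‖z‖ ≤ R →
      ‖((twistedDerivative b₀ (b k) (l k))^[n] q).eval z‖ ≤ (2 * B * L) ^ n * G := by
    intro n
    induction n with
    | zero => intro R h z hz; simpa using h z (by simpa using hz)
    | succ n ih =>
      intro R h z hz
      rw [Function.iterate_succ_apply', twistedDerivative]
      set q' := (twistedDerivative b₀ (b k) (l k))^[n] q with hq'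
      have h2 : ∀ z : ℂ, ‖z‖ ≤ R + 1 → ‖q'.eval z‖ ≤ (2 * B * L) ^ n * G :=
        ih (R + 1) fun z hz => h z (by push_cast; linarith)
      have h3 := norm_deriv_le_of_forall_norm_le q'.differentiable h2 hz
      rw [Polynomial.deriv] at h3
      have h4 := h2 z (by linarith)
      simp only [eval_sub, eval_mul, eval_intCast]
      refine (norm_sub_le _ _).trans ?_
      rw [norm_mul, norm_mul, Complex.norm_intCast, Complex.norm_intCast]
      push_cast
      rw [abs_mul, Nat.abs_cast]
      have h5 : 0 ≤ (2 * B * L) ^ n * G := (norm_nonneg _).trans h4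
      calc _ ≤ B * ((2 * B * L) ^ n * G) + B * L * ((2 * B * L) ^ n * G) := by
            gcongr
            · exact hb k
            · exact hl k
        _ ≤ B * L * ((2 * B * L) ^ n * G) + B * L * ((2 * B * L) ^ n * G) := by
            gcongr
            exact le_mul_of_one_le_right hB hL
        _ = _ := by ring
  have h2 := h1 (t k) R hq z hz
  rw [iteratedTwist, eval_mul, eval_intCast, norm_mul, Complex.norm_intCast,
    ← Finset.add_sum_erase _ _ (mem_univ k), pow_add, mul_comm ((2 * B * L) ^ t k), mul_assoc]
  gcongr
  push_cast
  rw [Finset.abs_prod, ← Finset.prod_pow_eq_pow_sum]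
  refine Finset.prod_le_prod (fun _ _ => abs_nonneg _) fun i _ => ?_
  rw [abs_pow]
  gcongr
  refine (abs_sub _ _).trans ?_
  rw [abs_mul, abs_mul, Nat.abs_cast, Nat.abs_cast]
  calc _ ≤ B * L + B * L := by
        gcongr
        · exact hb k
        · exact hl i
        · exact hb i
        · exact hl k
    _ = _ := by ring

end Twist

section AuxiliaryFunction

open Polynomial

variable {d : ℕ} {ι : Type*} [Fintype ι]

/-- The auxiliary function of Baker's method, together with the functions obtained from it by the
derivations of `iteratedTwist`; the exponent of its terms is perturbed by `ε * l k * (u z - z)`. -/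
noncomputable def bakerFun (b₀ : ℤ) (b : Fin d → ℤ) (k : Fin d) (a : Fin d → ℂ) (ε : ℂ)
    (u : ℂ → ℂ) (l : ι → Fin d → ℕ) (q : ι → ℂ[X]) (c : ι → ℂ) (t : Fin d → ℕ) (z : ℂ) : ℂ :=
  ∑ x, c x * (iteratedTwist b₀ b k (l x) t (q x)).eval z *
    Complex.exp ((∑ i, l x i * a i) * z + ε * l x k * (u z - z))

variable {b₀ : ℤ} {b : Fin d → ℤ} {k : Fin d} {a : Fin d → ℂ} {ε : ℂ} {u v : ℂ → ℂ}
  {l : ι → Fin d → ℕ} {q : ι → ℂ[X]} {c : ι → ℂ}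

theorem differentiable_bakerFun (hu : Differentiable ℂ u) (t : Fin d → ℕ) :
    Differentiable ℂ (bakerFun b₀ b k a ε u l q c t) := by
  unfold bakerFun
  fun_prop

theorem hasDerivAt_bakerFun (hu : ∀ z, HasDerivAt u (v z) z) (hk : b k ≠ 0)
    (hε : b k * ε = b₀ + ∑ i, b i * a i) (t : Fin d → ℕ) (z : ℂ) :
    HasDerivAt (bakerFun b₀ b k a ε u l q c t)
      (∑ i, (if i = k then 1 else a i) / b k *
          bakerFun b₀ b k a ε u l q c (t + Pi.single i 1) z +
        v z * bakerFun b₀ b k a ε u l q (fun x => c x * (ε * l x k)) t z) z := by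
  have hk' : (b k : ℂ) ≠ 0 := by exact_mod_cast hk
  have h1 : ∀ x, HasDerivAt (fun z => c x * (iteratedTwist b₀ b k (l x) t (q x)).eval z *
      Complex.exp ((∑ i, l x i * a i) * z + ε * l x k * (u z - z)))
      (c x * (derivative (iteratedTwist b₀ b k (l x) t (q x))).eval z *
        Complex.exp ((∑ i, l x i * a i) * z + ε * l x k * (u z - z)) +
      c x * (iteratedTwist b₀ b k (l x) t (q x)).eval z *
      (Complex.exp ((∑ i, l x i * a i) * z + ε * l x k * (u z - z)) *
        ((∑ i, l x i * a i) * 1 + ε * l x k * (v z - 1)))) z := by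
    intro x
    exact (((Polynomial.hasDerivAt _ z).const_mul (c x)).mul
      ((((hasDerivAt_id z).const_mul _).add
        (((hu z).sub (hasDerivAt_id z)).const_mul _)).cexp))
  have h2 := HasDerivAt.fun_sum (u := univ) fun x _ => h1 x
  refine HasDerivAt.congr_deriv h2 (Eq.symm ?_)
  simp only [bakerFun, mul_sum]
  rw [sum_comm, ← sum_add_distrib]
  refine sum_congr rfl fun x _ => ?_
  have hQ : ∀ i, i ≠ k → (iteratedTwist b₀ b k (l x) (t + Pi.single i 1) (q x)).eval z =
      (b k * l x i - b i * l x k) * (iteratedTwist b₀ b k (l x) t (q x)).eval z := by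
    intro i hi
    rw [iteratedTwist_add_single_of_ne _ _ _ _ _ _ hi, eval_mul, eval_intCast]
    push_cast
    ring
  have hQk : (iteratedTwist b₀ b k (l x) (t + Pi.single k 1) (q x)).eval z =
      b k * (derivative (iteratedTwist b₀ b k (l x) t (q x))).eval z -
        b₀ * l x k * (iteratedTwist b₀ b k (l x) t (q x)).eval z := by
    rw [iteratedTwist_add_single_self, twistedDerivative]
    simp
  set Q := (iteratedTwist b₀ b k (l x) t (q x)).eval z
  set E := Complex.exp ((∑ i, l x i * a i) * z + ε * l x k * (u z - z))
  have hs : ∑ i ∈ univ.erase k, (if i = k then 1 else a i) / b k *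
      (c x * (iteratedTwist b₀ b k (l x) (t + Pi.single i 1) (q x)).eval z * E) =
      c x * Q * E / b k * (b k * ∑ i ∈ univ.erase k, l x i * a i -
        l x k * ∑ i ∈ univ.erase k, b i * a i) := by
    rw [mul_sum, mul_sum, ← sum_sub_distrib, mul_sum]
    refine sum_congr rfl fun i hi => ?_
    rw [if_neg (ne_of_mem_erase hi), hQ i (ne_of_mem_erase hi)]
    ring
  rw [← add_sum_erase _ _ (mem_univ k), hs, if_pos rfl, hQk]
  rw [← add_sum_erase _ _ (mem_univ k)] at hε
  have hs2 : ∑ i, (l x i : ℂ) * a i = l x k * a k + ∑ i ∈ univ.erase k, l x i * a i :=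
    (add_sum_erase _ _ (mem_univ k)).symm
  rw [hs2]
  have hε' : ∑ i ∈ univ.erase k, b i * a i = b k * ε - b₀ - b k * a k := by
    rw [hε]; ring
  rw [hε']
  field_simp
  ring

theorem bakerFun_natCast {p : Fin d → ℕ} (hp : ∀ i, p i ≠ 0) (hu : ∀ s : ℕ, u s = s)
    (ha : ∀ i, a i = Real.log (p i)) (t : Fin d → ℕ) (s : ℕ) :
    bakerFun b₀ b k a ε u l q c t s =
      ∑ x, c x * (iteratedTwist b₀ b k (l x) t (q x)).eval (s : ℂ) *
        ((∏ i, p i ^ l x i : ℕ) : ℂ) ^ s := by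
  refine sum_congr rfl fun x _ => ?_
  rw [hu, sub_self, mul_zero, add_zero, mul_comm (∑ i, _), Complex.exp_nat_mul, Complex.exp_sum]
  congr 2
  push_cast
  refine prod_congr rfl fun i _ => ?_
  rw [Complex.exp_nat_mul, ha, ← Complex.ofReal_exp, Real.exp_log]
  · norm_cast
  · exact_mod_cast Nat.pos_of_ne_zero (hp i)

theorem exists_int_eq_mul_bakerFun {p : Fin d → ℕ} (hp : ∀ i, p i ≠ 0) (hu : ∀ s : ℕ, u s = s)
    (ha : ∀ i, a i = Real.log (p i)) {ν : ℕ} (hq : ∀ x, q x ∈ scaledIntegerValued ν)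
    {c : ι → ℤ} (t : Fin d → ℕ) (s : ℕ) :
    ∃ m : ℤ, (m : ℂ) = (ν : ℂ) ^ (∑ i, t i) *
      bakerFun b₀ b k a ε u l q (fun x => c x) t s := by
  have h1 : ∀ x, ∃ m : ℤ, (m : ℂ) = (ν : ℂ) ^ (∑ i, t i) *
      (iteratedTwist b₀ b k (l x) t (q x)).eval (s : ℂ) := by
    intro x
    obtain ⟨m, hm⟩ := mem_integerValued.1 (scaledIntegerValued_le ν
      (mul_iteratedTwist_mem_scaledIntegerValued b₀ b k (l x) t (q x) (hq x))) s
    exact ⟨m, by rw [hm]; simp⟩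
  choose m hm using h1
  refine ⟨∑ x, c x * m x * ((∏ i, p i ^ l x i : ℕ) : ℤ) ^ s, ?_⟩
  rw [bakerFun_natCast hp hu ha, mul_sum]
  push_cast
  refine sum_congr rfl fun x _ => ?_
  rw [hm]
  ring

theorem norm_bakerFun_le {B L R G κ Cc : ℝ} (hL : 1 ≤ L) (hb₀ : |(b₀ : ℝ)| ≤ B)
    (hb : ∀ i, |(b i : ℝ)| ≤ B) (hl : ∀ x i, (l x i : ℝ) ≤ L) (ha : ∀ i, ‖a i‖ ≤ κ)
    (hc : ∀ x, ‖c x‖ ≤ Cc) (t : Fin d → ℕ)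
    (hq : ∀ x, ∀ z : ℂ, ‖z‖ ≤ R + t k → ‖(q x).eval z‖ ≤ G)
    {z : ℂ} (hz : ‖z‖ ≤ R) (hε : ‖ε‖ * L * (‖u z‖ + R) ≤ 1) :
    ‖bakerFun b₀ b k a ε u l q c t z‖ ≤
      Fintype.card ι * (Cc * ((2 * B * L) ^ (∑ i, t i) * G) * Real.exp (d * κ * L * R + 1)) := by
  have h1 : ∀ x ∈ (univ : Finset ι), ‖c x * (iteratedTwist b₀ b k (l x) t (q x)).eval z *
      Complex.exp ((∑ i, l x i * a i) * z + ε * l x k * (u z - z))‖ ≤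
      Cc * ((2 * B * L) ^ (∑ i, t i) * G) * Real.exp (d * κ * L * R + 1) := by
    intro x _
    have hκ : 0 ≤ κ := (norm_nonneg _).trans (ha k)
    have h2 := norm_iteratedTwist_eval_le b₀ b k (l x) t (q x) hL hb₀ hb (hl x) (hq x) hz
    have hC : 0 ≤ Cc := (norm_nonneg _).trans (hc x)
    have hG : 0 ≤ (2 * B * L) ^ (∑ i, t i) * G := (norm_nonneg _).trans h2
    rw [norm_mul, norm_mul]
    refine mul_le_mul (mul_le_mul (hc x) h2 (norm_nonneg _) hC) ?_ (norm_nonneg _)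
      (mul_nonneg hC hG)
    refine (Complex.norm_exp_le_exp_norm _).trans ?_
    gcongr
    refine (norm_add_le _ _).trans (add_le_add ?_ ?_)
    · rw [norm_mul]
      gcongr
      refine (norm_sum_le _ _).trans ?_
      have h3 : ∀ i ∈ (univ : Finset (Fin d)), ‖(l x i : ℂ) * a i‖ ≤ L * κ := by
        intro i _
        rw [norm_mul, Complex.norm_natCast]
        gcongr
        · exact hl x i
        · exact ha i
      refine (sum_le_sum h3).trans (le_of_eq ?_)
      simp
      ring
    · refine le_trans ?_ hε
      rw [norm_mul, norm_mul, Complex.norm_natCast]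
      gcongr
      · exact hl x k
      · exact (norm_sub_le _ _).trans (by gcongr)
  refine (norm_sum_le _ _).trans ((sum_le_sum h1).trans (le_of_eq ?_))
  simp

theorem bakerFun_eq_zero_of_lt {p : Fin d → ℕ} (hp : ∀ i, p i ≠ 0) (hu : ∀ s : ℕ, u s = s)
    (huv : ∀ z, HasDerivAt u (v z) z)
    (ha : ∀ i, a i = Real.log (p i)) {ν : ℕ} (hν : 0 < ν) (hq : ∀ x, q x ∈ scaledIntegerValued ν)
    (hk : b k ≠ 0) (hε : b k * ε = b₀ + ∑ i, b i * a i) {c : ι → ℤ} {T S : ℕ}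
    (hvd : Differentiable ℂ v) (hv : ∀ s : ℕ, ((2 * T : ℕ) : ℕ∞) ≤ analyticOrderAt v (s : ℂ))
    (h0 : ∀ t : Fin d → ℕ, ∑ i, t i < 2 * T → ∀ s < S,
      bakerFun b₀ b k a ε u l q (fun x => c x) t s = 0)
    {r R A : ℝ} (hS : (S : ℝ) ≤ r) (hrR : r < R)
    (hA : ∀ t : Fin d → ℕ, ∑ i, t i < T → ∀ z, ‖z‖ = R →
      ‖bakerFun b₀ b k a ε u l q (fun x => c x) t z‖ ≤ A)
    (hsmall : (ν : ℝ) ^ T * (A * (2 * r / (R - r)) ^ (S * T)) < 1)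
    (t : Fin d → ℕ) (ht : ∑ i, t i < T) (s : ℕ) (hs : (s : ℝ) ≤ r) :
    bakerFun b₀ b k a ε u l q (fun x => c x) t s = 0 := by
  have hud : Differentiable ℂ u := fun z => (huv z).differentiableAt
  have h1 : ∀ s' < S, (T : ℕ∞) ≤
      analyticOrderAt (bakerFun b₀ b k a ε u l q (fun x => (c x : ℂ)) t) (s' : ℂ) := by
    intro s' hs'
    refine le_analyticOrderAt_of_hasDerivAt (T := 2 * T)
      (bakerFun b₀ b k a ε u l q (fun x => (c x : ℂ)))
      (bakerFun b₀ b k a ε u l q (fun x => (c x : ℂ) * (ε * l x k))) v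
      (fun i => (if i = k then 1 else a i) / b k) _ (hv s') hvd
      (fun t => differentiable_bakerFun hud t) (hasDerivAt_bakerFun huv hk hε)
      (fun t ht => h0 t ht s' hs') T t (by omega)
  have h2 := norm_le_of_analyticOrderAt (w := (s : ℂ)) (differentiable_bakerFun hud t) h1 hS hrR
    (hA t ht) (by simpa using hs)
  obtain ⟨m, hm⟩ := exists_int_eq_mul_bakerFun (b₀ := b₀) (b := b) (k := k) (ε := ε) (l := l)
    (c := c) hp hu ha hq t s
  have h3 : |(m : ℝ)| < 1 := by
    rw [← Complex.norm_intCast, hm, norm_mul, norm_pow, Complex.norm_natCast]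
    refine lt_of_le_of_lt ?_ hsmall
    have : (1 : ℝ) ≤ ν := by exact_mod_cast hν
    gcongr
  have h4 : m = 0 := by
    rw [← Int.abs_lt_one_iff]
    exact_mod_cast h3
  rw [h4] at hm
  have h5 : (ν : ℂ) ^ (∑ i, t i) ≠ 0 := pow_ne_zero _ (by exact_mod_cast hν.ne')
  simpa [h5] using hm.symm

end AuxiliaryFunction

section Extrapolation

open Polynomial

variable {d : ℕ} {ι : Type*} [Fintype ι]
variable {b₀ : ℤ} {b : Fin d → ℤ} {k : Fin d} {a : Fin d → ℂ} {ε : ℂ} {u v : ℂ → ℂ}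
  {l : ι → Fin d → ℕ} {q : ι → ℂ[X]} {c : ι → ℤ}

set_option maxHeartbeats 400000 in
theorem extrapolation_small {d J T₀ A M L h T S : ℕ} {κ W R n : ℝ} (hd : 1 ≤ d)
    (hT₀ : 1 ≤ T₀) (hκ : 1 ≤ κ) (hA : 1 ≤ A) (hh : 1 ≤ h) (hM : 1 ≤ M)
    (hW : 40 * d * 2 ^ J ≤ W)
    (hMT : (6 * M + 2 * d * κ * L) * (3 * Real.exp W) * A ≤ T₀)
    (hTT : 2 * T ≤ 2 ^ J * T₀) (hT : T₀ ≤ T) (hTh : d * (2 ^ J * T₀) ≤ h) (hS : h ≤ S)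
    (hR : R = A * S * (1 + 2 * Real.exp W)) (hn₀ : 0 ≤ n) (hn : n ≤ Real.exp h) {Bl : ℝ}
    (hBl : Bl ≤ Real.exp (2 * h)) {ν : ℕ} (hν : (ν : ℝ) ≤ Real.exp (6 * h)) {Cc : ℝ}
    (hCc₀ : 0 ≤ Cc)
    (hCc : Cc ≤ Real.exp (h + 8 * d * (2 ^ J * T₀) * h + 3 * M * h + d * κ * L * h)) :
    (ν : ℝ) ^ T * (n * (Cc * ((max 1 Bl) ^ T * Real.exp (M * (R + T + h))) *
      Real.exp (d * κ * L * R + 1)) * (2 * (A * S : ℝ) / (R - A * S)) ^ (S * T)) < 1 := by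
  have hd' : (1 : ℝ) ≤ d := by exact_mod_cast hd
  have hA' : (1 : ℝ) ≤ A := by exact_mod_cast hA
  have hh' : (1 : ℝ) ≤ h := by exact_mod_cast hh
  have hT₀' : (1 : ℝ) ≤ T₀ := by exact_mod_cast hT₀
  have hM' : (1 : ℝ) ≤ M := by exact_mod_cast hM
  have hS' : (h : ℝ) ≤ S := by exact_mod_cast hS
  have hT' : (T₀ : ℝ) ≤ T := by exact_mod_cast hT
  have hTT' : 2 * (T : ℝ) ≤ 2 ^ J * T₀ := by exact_mod_cast hTT
  have hTh' : d * (2 ^ J * (T₀ : ℝ)) ≤ h := by exact_mod_cast hTh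
  have hAS : 0 < (A : ℝ) * S := by nlinarith
  have h1 : 2 * (A * S : ℝ) / (R - A * S) = Real.exp (-W) := by
    have h2 : R - A * S = 2 * (A * S : ℝ) * Real.exp W := by rw [hR]; ring
    rw [h2, Real.exp_neg, div_mul_eq_div_div, div_self (by positivity), one_div]
  have hm : max 1 Bl ≤ Real.exp (2 * h) := max_le (Real.one_le_exp (by positivity)) hBl
  rw [h1]
  have h2J : (1 : ℝ) ≤ 2 ^ J := one_le_pow₀ (by norm_num)
  have hW1 : 1 ≤ Real.exp W := Real.one_le_exp (le_trans (by positivity) hW)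
  have hRh : h ≤ R := by
    calc (h : ℝ) ≤ 1 * S * (1 + 0) := by linarith
      _ ≤ A * S * (1 + 2 * Real.exp W) := by gcongr; positivity
      _ = R := hR.symm
  have hTR : T + h ≤ 2 * R := by
    have : (T : ℝ) ≤ d * (2 ^ J * T₀) := by
      have : 1 * (2 ^ J * (T₀ : ℝ)) ≤ d * (2 ^ J * T₀) := by gcongr
      linarith
    linarith
  have hR3 : R ≤ 3 * Real.exp W * A * S := by
    calc R = A * S * (1 + 2 * Real.exp W) := hR
      _ ≤ A * S * (Real.exp W + 2 * Real.exp W) := by gcongr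
      _ = _ := by ring
  calc (ν : ℝ) ^ T * (n * (Cc * ((max 1 Bl) ^ T * Real.exp (M * (R + T + h))) *
      Real.exp (d * κ * L * R + 1)) * (Real.exp (-W)) ^ (S * T))
      ≤ (Real.exp (6 * h)) ^ T * (Real.exp h *
        (Real.exp (h + 8 * d * (2 ^ J * T₀) * h + 3 * M * h + d * κ * L * h) *
        ((Real.exp (2 * h)) ^ T * Real.exp (M * (R + T + h))) *
      Real.exp (d * κ * L * R + 1)) * (Real.exp (-W)) ^ (S * T)) := by gcongr
    _ = Real.exp (6 * h * T + (h + ((h + 8 * d * (2 ^ J * T₀) * h + 3 * M * h + d * κ * L * h)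
        + (2 * h * T + M * (R + T + h)) + (d * κ * L * R + 1))) - W * (S * T)) := by
      simp only [← Real.exp_nat_mul, ← Real.exp_add]
      congr 1
      push_cast
      ring
    _ < 1 := by
      rw [Real.exp_lt_one_iff]
      have hX : (h : ℝ) * T₀ ≤ S * T := by gcongr
      have e1 : W * (S * T) ≥ 40 * d * 2 ^ J * (S * T) := by gcongr
      have e2 : (6 * M + 2 * d * κ * L) * R ≤ S * T := by
        calc (6 * M + 2 * d * κ * L) * R ≤ (6 * M + 2 * d * κ * L) * (3 * Real.exp W * A * S) := by
              gcongr
          _ = (6 * M + 2 * d * κ * L) * (3 * Real.exp W) * A * S := by ring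
          _ ≤ T₀ * S := by gcongr
          _ ≤ S * T := by rw [mul_comm]; gcongr
      have e3 : 20 * d * 2 ^ J * (h * T₀) ≤ 20 * d * 2 ^ J * (S * T : ℝ) := by gcongr
      have e4 : (1 : ℝ) ≤ d * (2 ^ J * T₀) := by
        calc (1 : ℝ) = 1 * (1 * 1) := by norm_num
          _ ≤ _ := by gcongr
      have e5 : d * κ * L * h ≤ d * κ * L * R := by gcongr
      have e6 : (M : ℝ) * h ≤ M * R := by gcongr
      have e7 : M * (R + T + h) ≤ M * (R + 2 * R) := by gcongr M * ?_; linarith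
      have e8 : 8 * (h * T : ℝ) ≤ 4 * (h * (d * (2 ^ J * T₀))) := by
        have e : 1 * (2 ^ J * (T₀ : ℝ)) ≤ d * (2 ^ J * T₀) := by gcongr
        have e' : 2 * (T : ℝ) ≤ d * (2 ^ J * T₀) := by linarith
        have e'' : h * (2 * (T : ℝ)) ≤ h * (d * (2 ^ J * T₀)) := by gcongr
        linarith
      have e9 : (h : ℝ) * 1 ≤ h * (d * (2 ^ J * T₀)) := by gcongr
      have e10 : (1 : ℝ) * 1 ≤ S * T := by gcongr <;> linarith
      have e11 : 1 * 1 * (S * T : ℝ) ≤ d * 2 ^ J * (S * T) := by gcongr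
      linarith

theorem bakerFun_eq_zero_of_extrapolation {p : Fin d → ℕ} (hp : ∀ i, p i ≠ 0)
    (hu : ∀ s : ℕ, u s = s) (huv : ∀ z, HasDerivAt u (v z) z)
    (ha : ∀ i, a i = Real.log (p i)) {ν : ℕ} (hν : 0 < ν) (hq : ∀ x, q x ∈ scaledIntegerValued ν)
    (hk : b k ≠ 0) (hε : b k * ε = b₀ + ∑ i, b i * a i) (hvd : Differentiable ℂ v)
    {J T₀ A M L h : ℕ} {κ W : ℝ}
    (hT₀ : 1 ≤ T₀) (hκ : 1 ≤ κ) (hA : 1 ≤ A) (hh : 1 ≤ h) (hM : 1 ≤ M) (hL : 1 ≤ L)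
    (hW : 40 * d * 2 ^ J ≤ W)
    (hMT : (6 * M + 2 * d * κ * L) * (3 * Real.exp W) * A ≤ T₀)
    (hTh : d * (2 ^ J * T₀) ≤ h)
    (hv : ∀ s : ℕ, ((2 ^ J * T₀ : ℕ) : ℕ∞) ≤ analyticOrderAt v (s : ℂ))
    (hι : Fintype.card ι ≤ Real.exp h)
    {B : ℝ} (hb₀ : |(b₀ : ℝ)| ≤ B) (hb : ∀ i, |(b i : ℝ)| ≤ B)
    (hBL : 2 * B * L ≤ Real.exp (2 * h))
    (hl : ∀ x i, l x i ≤ L) (hκa : ∀ i, ‖a i‖ ≤ κ)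
    (hν' : (ν : ℝ) ≤ Real.exp (6 * h))
    (hqn : ∀ x, ∀ z, ‖(q x).eval z‖ ≤ Real.exp (M * (‖z‖ + h)))
    (hc : ∀ x, |(c x : ℝ)| ≤
      Real.exp (h + 8 * d * (2 ^ J * T₀) * h + 3 * M * h + d * κ * L * h))
    (hεu : ∀ z, ‖z‖ ≤ 3 * Real.exp W * A ^ J * h →
      ‖ε‖ * L * (‖u z‖ + 3 * Real.exp W * A ^ J * h) ≤ 1)
    (h0 : ∀ t : Fin d → ℕ, ∑ i, t i < 2 ^ J * T₀ → ∀ s < h,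
      bakerFun b₀ b k a ε u l q (fun x => c x) t s = 0)
    (s : ℕ) (hs : s < h * A ^ J) :
    bakerFun b₀ b k a ε u l q (fun x => c x) 0 s = 0 := by
  have hd : 1 ≤ d := k.pos
  have hW0 : 0 ≤ W := le_trans (by positivity) hW
  have key : ∀ j ≤ J, ∀ t : Fin d → ℕ, ∑ i, t i < 2 ^ (J - j) * T₀ → ∀ s < h * A ^ j,
      bakerFun b₀ b k a ε u l q (fun x => c x) t s = 0 := by
    intro j
    induction j with
    | zero => intro _ t ht s hs; exact h0 t (by simpa using ht) s (by simpa using hs)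
    | succ j ih =>
      intro hj t ht s hs
      have ih := ih (by omega)
      set T := 2 ^ (J - (j + 1)) * T₀ with hTdef
      set S := h * A ^ j with hSdef
      have h2 : 2 ^ (J - j) * T₀ = 2 * T := by
        rw [hTdef, show J - j = J - (j + 1) + 1 by omega, pow_succ]; ring
      rw [h2] at ih
      have hTT : 2 * T ≤ 2 ^ J * T₀ := by
        rw [← h2]
        gcongr
        · norm_num
        · omega
      have hT : T₀ ≤ T := Nat.le_mul_of_pos_left _ (by positivity)
      have hS : h ≤ S := Nat.le_mul_of_pos_right _ (by positivity)
      have hE1 : 1 ≤ Real.exp W := Real.one_le_exp hW0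
      have hS0 : 0 < (S : ℝ) := by exact_mod_cast (hh.trans hS)
      have hA0 : (1 : ℝ) ≤ A := by exact_mod_cast hA
      have hRR : (A * S : ℝ) * (1 + 2 * Real.exp W) ≤ 3 * Real.exp W * A ^ J * h := by
        calc (A * S : ℝ) * (1 + 2 * Real.exp W)
            ≤ A * S * (Real.exp W + 2 * Real.exp W) := by gcongr
          _ = 3 * Real.exp W * A ^ (j + 1) * h := by
            rw [hSdef]; push_cast; ring
          _ ≤ _ := by gcongr
      refine bakerFun_eq_zero_of_lt (r := A * S) (R := A * S * (1 + 2 * Real.exp W)) hp hu huv ha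
        hν hq hk hε hvd (fun s => le_trans (by exact_mod_cast hTT) (hv s)) ih ?_ ?_ ?_
        (extrapolation_small hd hT₀ hκ hA hh hM hW hMT hTT hT hTh hS rfl (Nat.cast_nonneg _)
          hι hBL hν' (Real.exp_pos _).le le_rfl) t ht s ?_
      · exact le_mul_of_one_le_left hS0.le hA0
      · have : 0 < (A : ℝ) * S := by positivity
        exact lt_mul_of_one_lt_right this (by linarith)
      · intro t ht z hz
        have hB : 0 ≤ B := (abs_nonneg _).trans hb₀
        have htk : t k ≤ T := (single_le_sum (fun _ _ => Nat.zero_le _) (mem_univ k)).trans ht.le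
        refine (norm_bakerFun_le (L := L) (κ := κ) (by exact_mod_cast hL) hb₀ hb
          (fun x i => by exact_mod_cast hl x i) hκa
          (fun x => (by simpa using hc x)) t
          (G := Real.exp (M * (A * S * (1 + 2 * Real.exp W) + T + h)))
          ?_ hz.le ?_).trans ?_
        · intro x z hz
          refine (hqn x z).trans ?_
          have : (t k : ℝ) ≤ T := by exact_mod_cast htk
          gcongr
          linarith
        · refine le_trans ?_ (hεu z (hz.le.trans hRR))
          gcongr
        · gcongr
          calc (2 * B * L) ^ (∑ i, t i) ≤ (max 1 (2 * B * L)) ^ (∑ i, t i) := by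
                gcongr; exact le_max_right _ _
            _ ≤ _ := by
              gcongr
              exact le_max_left _ _
      · have : s ≤ A * S := by
          rw [hSdef]
          calc s ≤ h * A ^ (j + 1) := hs.le
            _ = _ := by ring
        exact_mod_cast this
  exact key J le_rfl 0 (by simp; omega) s hs

end Extrapolation

section Siegel

attribute [local instance] Matrix.seminormedAddCommGroup in
theorem exists_int_vec_of_card_eq_two_mul {α β : Type*} [Fintype α] [Fintype β]
    (A : Matrix α β ℤ) {X : ℝ} (hX : 1 ≤ X) (hA : ∀ i j, |(A i j : ℝ)| ≤ X)
    (hcard : Fintype.card β = 2 * Fintype.card α) (hα : 0 < Fintype.card α) :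
    ∃ c : β → ℤ, c ≠ 0 ∧ (∀ i, ∑ j, A i j * c j = 0) ∧
      ∀ j, |(c j : ℝ)| ≤ Fintype.card β * X := by
  obtain ⟨c, hc, hAc, hn⟩ := Int.Matrix.exists_ne_zero_int_vec_norm_le A (by omega) hα
  refine ⟨c, hc, fun i => congrFun hAc i, fun j => ?_⟩
  have h1 : ((Fintype.card α : ℝ) / (Fintype.card β - Fintype.card α)) = 1 := by
    rw [hcard]
    push_cast
    rw [two_mul, add_sub_cancel_right, div_self]
    exact_mod_cast hα.ne'
  rw [h1, Real.rpow_one] at hn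
  have h2 : ‖A‖ ≤ X := by
    rw [Matrix.norm_le_iff (by linarith)]
    intro i j
    rw [Int.norm_eq_abs]
    exact hA i j
  calc |(c j : ℝ)| = ‖c j‖ := (Int.norm_eq_abs _).symm
    _ ≤ ‖c‖ := norm_le_pi_norm c j
    _ ≤ _ := hn
    _ ≤ _ := by gcongr; exact max_le hX h2

theorem exists_common_multiple_le_exp (h : ℕ) :
    ∃ ν : ℕ, 0 < ν ∧ (∀ j ∈ Finset.Icc 1 h, j ∣ ν) ∧ (ν : ℝ) ≤ Real.exp (6 * h) := by
  refine ⟨Nat.lcmUpto h, Nat.lcmUpto_pos h, fun j hj => Finset.dvd_lcm (f := id) hj, ?_⟩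
  have h1 := Chebyshev.psi_le_const_mul_self (Nat.cast_nonneg (α := ℝ) h)
  rw [Chebyshev.psi_eq_log_lcmUpto] at h1
  rw [← Real.log_le_iff_le_exp (by exact_mod_cast Nat.lcmUpto_pos h)]
  refine h1.trans ?_
  gcongr
  have h4 : Real.log 4 = 2 * Real.log 2 := by
    rw [show (4 : ℝ) = 2 ^ 2 by norm_num, Real.log_pow]; norm_num
  linarith [Real.log_two_lt_d9]

theorem eq_zero_of_sum_binomProd_mul_pow_eq_zero {d : ℕ} {p : Fin d → ℕ} (hp : ∀ i, (p i).Prime)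
    (hinj : Function.Injective p) {h L N : ℕ} (c : (Fin d → Fin L) × Fin N → ℂ)
    (h0 : ∀ s < L ^ d * N, ∑ x, c x * (binomProd h x.2).eval (s : ℂ) *
      ((∏ i, p i ^ (x.1 i : ℕ) : ℕ) : ℂ) ^ s = 0) : c = 0 := by
  set P : (Fin d → Fin L) → Polynomial ℂ := fun l => ∑ r, c (l, r) • binomProd h r with hPdef
  have h1 : ∀ l ∈ (univ : Finset (Fin d → Fin L)), P l = 0 := by
    refine eq_zero_of_sum_eval_mul_pow_eq_zero univ
      (fun l => ((∏ i, p i ^ (l i : ℕ) : ℕ) : ℂ)) ?_ ?_ P (fun _ => N) ?_ ?_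
    · intro l _ l' _ hl
      have h2 := prod_pow_injective hp hinj
        (a₁ := fun i => (l i : ℕ)) (a₂ := fun i => (l' i : ℕ)) (Nat.cast_injective (R := ℂ) hl)
      funext i
      exact Fin.ext (congrFun h2 i)
    · intro l _
      exact_mod_cast Finset.prod_ne_zero_iff.2 fun i _ => pow_ne_zero _ (hp i).ne_zero
    · intro l _
      refine Polynomial.mem_degreeLT.1 (Submodule.sum_mem _ fun r _ => Submodule.smul_mem _ _ ?_)
      rw [Polynomial.mem_degreeLT, Polynomial.degree_eq_natDegree (binomProd_ne_zero h r),
        natDegree_binomProd]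
      exact_mod_cast r.2
    · intro s hs
      rw [← h0 s (by simpa using hs), Fintype.sum_prod_type]
      refine Finset.sum_congr rfl fun l _ => ?_
      rw [hPdef, Polynomial.eval_finsetSum, Finset.sum_mul]
      refine Finset.sum_congr rfl fun r _ => ?_
      rw [Polynomial.eval_smul, smul_eq_mul]
  have h2 : LinearIndependent ℂ (fun r : Fin N => binomProd h r) :=
    (linearIndependent_binomProd h).comp (fun r : Fin N => (r : ℕ)) Fin.val_injective
  funext ⟨l, r⟩
  exact Fintype.linearIndependent_iff.1 h2 (fun r => c (l, r)) (h1 l (mem_univ l)) r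

end Siegel

section LinearForms

theorem exists_baker_parameters (d : ℕ) (hd : 1 ≤ d) (κ : ℝ) :
    ∃ (J T₀ A M L : ℕ) (W : ℝ), 1 ≤ T₀ ∧ 1 ≤ A ∧ 1 ≤ M ∧ 1 ≤ L ∧ 40 * d * 2 ^ J ≤ W ∧
      (6 * M + 2 * d * κ * L) * (3 * Real.exp W) * A ≤ T₀ ∧
      M * L ^ d = 2 * (2 ^ J * T₀) ^ d ∧ M * L ^ d ≤ A ^ J := by
  set J := 4 * d ^ 2 + 1
  set W : ℝ := 40 * d * 2 ^ J
  obtain ⟨A, hA⟩ := exists_nat_ge (max (2 ^ (J * d + 1))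
    (3 * Real.exp W * (12 * 2 ^ (J * d) + 2 * d * κ)))
  have hA1 : 2 ^ (J * d + 1) ≤ A := by exact_mod_cast (le_max_left _ _).trans hA
  have hA2 := (le_max_right _ _).trans hA
  have hA0 : 1 ≤ A := le_trans Nat.one_le_two_pow hA1
  have hA0' : (1 : ℝ) ≤ A := by exact_mod_cast hA0
  have hprod : 2 * 2 ^ (J * d) * A ^ (2 * d) * (A ^ (4 * d - 2)) ^ d =
      2 * 2 ^ (J * d) * A ^ (4 * d ^ 2) := by
    rw [mul_assoc, ← pow_mul, ← pow_add]
    congr 2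
    obtain ⟨e, rfl⟩ : ∃ e, d = e + 1 := ⟨d - 1, by omega⟩
    rw [show 4 * (e + 1) - 2 = 4 * e + 2 by omega]
    ring
  refine ⟨J, A ^ (4 * d), A, 2 * 2 ^ (J * d) * A ^ (2 * d), A ^ (4 * d - 2), W,
    Nat.one_le_pow _ _ hA0, hA0, ?_, Nat.one_le_pow _ _ hA0, le_rfl, ?_, ?_, ?_⟩
  · exact Nat.pos_of_ne_zero (by positivity)
  · push_cast
    have h1 : (A : ℝ) ^ (2 * d) ≤ A ^ (4 * d - 2) := pow_le_pow_right₀ hA0' (by omega)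
    have hE := Real.exp_pos W
    calc (6 * (2 * 2 ^ (J * d) * (A : ℝ) ^ (2 * d)) + 2 * d * κ * A ^ (4 * d - 2)) *
          (3 * Real.exp W) * A
        ≤ (6 * (2 * 2 ^ (J * d) * (A : ℝ) ^ (4 * d - 2)) + 2 * d * κ * A ^ (4 * d - 2)) *
          (3 * Real.exp W) * A := by gcongr
      _ = (3 * Real.exp W * (12 * 2 ^ (J * d) + 2 * d * κ)) * (A ^ (4 * d - 2) * A) := by ring
      _ ≤ A * (A ^ (4 * d - 2) * A) := by gcongr
      _ = A ^ (4 * d) := by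
        rw [← pow_succ, ← pow_succ']
        congr 1
        omega
  · rw [hprod, mul_pow, ← pow_mul, ← pow_mul, mul_assoc]
    congr 3
    ring
  · rw [hprod]
    calc 2 * 2 ^ (J * d) * A ^ (4 * d ^ 2) = 2 ^ (J * d + 1) * A ^ (4 * d ^ 2) := by ring
      _ ≤ A * A ^ (4 * d ^ 2) := by gcongr
      _ = A ^ J := (pow_succ' _ _).symm

variable {d : ℕ} {p : Fin d → ℕ}

open Polynomial in
theorem exists_int_eq_mul_iteratedTwist {b₀ : ℤ} {b : Fin d → ℤ} {k : Fin d} {ν h M L T : ℕ}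
    {q : ℂ[X]} {κ : ℝ} (hp : ∀ i, (p i).Prime) (hκ : ∀ i, Real.log (p i) ≤ κ)
    (hL : 1 ≤ L) (hν₀ : 0 < ν) (hν : (ν : ℝ) ≤ Real.exp (6 * h)) (hTh : d * T ≤ h)
    (hLh : 2 * (L : ℝ) ≤ Real.exp h)
    (hb₀ : |(b₀ : ℝ)| ≤ Real.exp h) (hb : ∀ i, |(b i : ℝ)| ≤ Real.exp h)
    (hq : q ∈ scaledIntegerValued ν) (hqn : ∀ z, ‖q.eval z‖ ≤ Real.exp (M * (‖z‖ + h)))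
    {l t : Fin d → ℕ} (hl : ∀ i, l i ≤ L) (ht : ∀ i, t i ≤ T) {s : ℕ} (hs : s ≤ h) :
    ∃ m : ℤ, (m : ℂ) = (ν : ℂ) ^ (∑ i, t i) * (iteratedTwist b₀ b k l t q).eval (s : ℂ) *
        ((∏ i, p i ^ l i : ℕ) : ℂ) ^ s ∧
      |(m : ℝ)| ≤ Real.exp (8 * d * T * h + 3 * M * h + d * κ * L * h) := by
  obtain ⟨m, hm⟩ := mem_integerValued.1 (scaledIntegerValued_le ν
      (mul_iteratedTwist_mem_scaledIntegerValued b₀ b k l t q hq)) s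
  have hd : 1 ≤ d := k.pos
  have hκ0 : 0 ≤ κ := (Real.log_natCast_nonneg _).trans (hκ k)
  have hm' : ((m * ((∏ i, p i ^ l i : ℕ) : ℤ) ^ s : ℤ) : ℂ) =
      (ν : ℂ) ^ (∑ i, t i) * (iteratedTwist b₀ b k l t q).eval (s : ℂ) *
        ((∏ i, p i ^ l i : ℕ) : ℂ) ^ s := by
    rw [Int.cast_mul, hm]
    simp
  refine ⟨_, hm', ?_⟩
  rw [← Complex.norm_intCast, hm', norm_mul, norm_mul, norm_pow, norm_pow, Complex.norm_natCast,
    Complex.norm_natCast]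
  have hsum : ∑ i, t i ≤ d * T := by
    refine (sum_le_sum fun i _ => ht i).trans (le_of_eq ?_)
    simp
  have hth : (t k : ℝ) ≤ h := by
    have : t k ≤ h := (ht k).trans (le_trans (Nat.le_mul_of_pos_left _ hd) hTh)
    exact_mod_cast this
  have hs' : (s : ℝ) ≤ h := by exact_mod_cast hs
  have hL' : (1 : ℝ) ≤ L := by exact_mod_cast hL
  have hν1 : (1 : ℝ) ≤ ν := by exact_mod_cast hν₀
  have h1 := norm_iteratedTwist_eval_le b₀ b k l t q (L := L) hL' hb₀ hb
    (fun i => by exact_mod_cast hl i) (R := h) (G := Real.exp (M * (h + h + h)))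
    (fun z hz => (hqn z).trans (by gcongr; linarith)) (z := (s : ℂ)) (by simpa using hs')
  have h2 : 2 * Real.exp h * L ≤ Real.exp (2 * h) := by
    calc 2 * Real.exp h * L = Real.exp h * (2 * L) := by ring
      _ ≤ Real.exp h * Real.exp h := by gcongr
      _ = _ := by rw [← Real.exp_add]; ring_nf
  have h3 : 1 ≤ 2 * Real.exp h * L := by
    have : 1 ≤ Real.exp h := Real.one_le_exp (Nat.cast_nonneg _)
    calc (1 : ℝ) = 1 * 1 * 1 := by norm_num
      _ ≤ _ := by gcongr; norm_num
  have h4 : ((∏ i, p i ^ l i : ℕ) : ℝ) ≤ Real.exp (d * κ * L) := by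
    push_cast
    calc ∏ i, (p i : ℝ) ^ l i ≤ ∏ _i : Fin d, Real.exp (κ * L) := by
          refine prod_le_prod (fun _ _ => by positivity) fun i _ => ?_
          have hpi : (0 : ℝ) < p i := by exact_mod_cast (hp i).pos
          rw [← Real.exp_log hpi, ← Real.exp_nat_mul, mul_comm]
          have : (l i : ℝ) ≤ L := by exact_mod_cast hl i
          have := Real.log_natCast_nonneg (p i)
          gcongr
          exact hκ i
      _ = _ := by
        rw [prod_const, ← Real.exp_nat_mul]
        simp [mul_assoc]
  have h5 : (1 : ℝ) ≤ ((∏ i, p i ^ l i : ℕ) : ℝ) := by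
    have : 0 < ∏ i, p i ^ l i := prod_pos fun i _ => pow_pos (hp i).pos _
    exact_mod_cast this
  calc (ν : ℝ) ^ (∑ i, t i) * ‖(iteratedTwist b₀ b k l t q).eval (s : ℂ)‖ *
        ((∏ i, p i ^ l i : ℕ) : ℝ) ^ s
      ≤ ν ^ (d * T) * ((2 * Real.exp h * L) ^ (d * T) * Real.exp (M * (h + h + h))) *
        ((∏ i, p i ^ l i : ℕ) : ℝ) ^ h := by
        refine mul_le_mul (mul_le_mul (pow_le_pow_right₀ hν1 hsum) (h1.trans ?_) (norm_nonneg _)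
          (by positivity)) (pow_le_pow_right₀ h5 hs) (by positivity) (by positivity)
        gcongr
    _ ≤ Real.exp (6 * h) ^ (d * T) * (Real.exp (2 * h) ^ (d * T) * Real.exp (M * (h + h + h))) *
        Real.exp (d * κ * L) ^ h := by gcongr
    _ = _ := by
      simp only [← Real.exp_nat_mul, ← Real.exp_add]
      congr 1
      push_cast
      ring

open Polynomial in
theorem exp_neg_lt_abs_linearForm_of_parameters (hp : ∀ i, (p i).Prime)
    (hinj : Function.Injective p) {κ : ℝ} (hκ1 : 1 ≤ κ) (hκ : ∀ i, Real.log (p i) ≤ κ)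
    {J T₀ A M L : ℕ} {W K : ℝ} (hT₀ : 1 ≤ T₀) (hA : 1 ≤ A) (hM : 1 ≤ M) (hL : 1 ≤ L)
    (hW : 40 * d * 2 ^ J ≤ W)
    (hMT : (6 * M + 2 * d * κ * L) * (3 * Real.exp W) * A ≤ T₀)
    (hML : M * L ^ d = 2 * (2 ^ J * T₀) ^ d) (hMA : M * L ^ d ≤ A ^ J)
    {u v : ℂ → ℂ} (hK : 1 ≤ K) (huv : ∀ z, HasDerivAt u (v z) z) (hvd : Differentiable ℂ v)
    (hv : ∀ s : ℕ, ((2 ^ J * T₀ : ℕ) : ℕ∞) ≤ analyticOrderAt v (s : ℂ))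
    (hu : ∀ s : ℕ, u s = s) (hun : ∀ z, ‖u z‖ ≤ K * Real.exp (K * ‖z‖))
    {h : ℕ} (hh : 1 ≤ h) (hTh : d * (2 ^ J * T₀) ≤ h) (hLh : 2 * (L : ℝ) ≤ Real.exp h)
    (hTLh : 2 * (2 ^ J * T₀ : ℝ) ^ d * h ≤ Real.exp h)
    {b₀ : ℤ} {b : Fin d → ℤ} (hb₀ : |(b₀ : ℝ)| ≤ Real.exp h)
    (hb : ∀ i, |(b i : ℝ)| ≤ Real.exp h) {k : Fin d} (hk : b k ≠ 0) :
    Real.exp (-((2 * K * L + K * (3 * Real.exp W * A ^ J)) * h)) <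
      |b₀ + ∑ i, b i * Real.log (p i)| := by
  by_contra! hΛ
  set Λ : ℝ := b₀ + ∑ i, b i * Real.log (p i) with hΛdef
  set T := 2 ^ J * T₀ with hTdef
  have hT : 1 ≤ T := Nat.pos_of_ne_zero (by positivity)
  obtain ⟨ν, hν₀, hνd, hν⟩ := exists_common_multiple_le_exp h
  let l : (Fin d → Fin L) × Fin (h * M) → Fin d → ℕ := fun x i => x.1 i
  let q : (Fin d → Fin L) × Fin (h * M) → ℂ[X] := fun x => binomProd h x.2
  have hq : ∀ x, q x ∈ scaledIntegerValued ν := fun x =>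
    binomProd_mem_scaledIntegerValued hh hνd _
  have hqn : ∀ x, ∀ z, ‖(q x).eval z‖ ≤ Real.exp (M * (‖z‖ + h)) := fun x z =>
    norm_binomProd_eval_le x.2.2 z
  have hl : ∀ x i, l x i ≤ L := fun x i => (x.1 i).2.le
  have hentry := fun (y : (Fin d → Fin T) × Fin h) (x : (Fin d → Fin L) × Fin (h * M)) =>
    exists_int_eq_mul_iteratedTwist (k := k) hp hκ hL hν₀ hν hTh hLh hb₀ hb (hq x) (hqn x) (hl x)
      (t := fun i => y.1 i) (fun i => (y.1 i).2.le) y.2.2.le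
  choose m hm hmn using hentry
  have hcard : Fintype.card ((Fin d → Fin L) × Fin (h * M)) = 2 * (T ^ d * h) := by
    simp only [Fintype.card_prod, Fintype.card_fun, Fintype.card_fin]
    rw [← mul_assoc 2, ← hML]
    ring
  have hcard' : (Fintype.card ((Fin d → Fin L) × Fin (h * M)) : ℝ) ≤ Real.exp h := by
    rw [hcard]
    refine le_trans (le_of_eq ?_) hTLh
    rw [hTdef]
    push_cast
    ring
  have hκ0 : 0 ≤ κ := by linarith
  obtain ⟨c, hc0, hc, hcn⟩ := exists_int_vec_of_card_eq_two_mul (Matrix.of m)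
    (Real.one_le_exp (by positivity)) hmn (by rw [hcard]; simp)
    (by simp; exact ⟨Nat.pow_pos hT, hh⟩)
  refine hc0 ?_
  set a : Fin d → ℂ := fun i => Real.log (p i) with hadef
  set ε : ℂ := ((Λ / b k : ℝ) : ℂ) with hεdef
  have hbk : (b k : ℝ) ≠ 0 := by exact_mod_cast hk
  have hε : b k * ε = b₀ + ∑ i, b i * a i := by
    have : (b k : ℝ) * (Λ / b k) = b₀ + ∑ i, b i * Real.log (p i) := by
      rw [mul_div_cancel₀ _ hbk]
    rw [hεdef]
    simp only [hadef]
    exact_mod_cast this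
  have hεn : ‖ε‖ ≤ |Λ| := by
    rw [hεdef, Complex.norm_real, Real.norm_eq_abs, abs_div]
    refine div_le_self (abs_nonneg _) ?_
    exact_mod_cast Int.one_le_abs hk
  have hp0 : ∀ i, p i ≠ 0 := fun i => (hp i).ne_zero
  have hh' : (1 : ℝ) ≤ h := by exact_mod_cast hh
  have hκa : ∀ i, ‖a i‖ ≤ κ := by
    intro i
    rw [hadef, Complex.norm_real, Real.norm_of_nonneg (Real.log_natCast_nonneg _)]
    exact hκ i
  have hH0 : ∀ t : Fin d → ℕ, ∑ i, t i < T → ∀ s < h,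
      bakerFun b₀ b k a ε u l q (fun x => c x) t s = 0 := by
    intro t ht s hs
    have hti : ∀ i, t i < T := fun i =>
      (single_le_sum (fun _ _ => Nat.zero_le _) (mem_univ i)).trans_lt ht
    have h1 : (∑ x, m (fun i => ⟨t i, hti i⟩, ⟨s, hs⟩) x * c x : ℤ) = 0 :=
      hc (fun i => ⟨t i, hti i⟩, ⟨s, hs⟩)
    have h2 : ((∑ x, m (fun i => ⟨t i, hti i⟩, ⟨s, hs⟩) x * c x : ℤ) : ℂ) =
        (ν : ℂ) ^ (∑ i, t i) * bakerFun b₀ b k a ε u l q (fun x => c x) t s := by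
      rw [bakerFun_natCast hp0 hu (fun _ => rfl), mul_sum]
      push_cast
      refine sum_congr rfl fun x _ => ?_
      rw [hm]
      push_cast
      ring
    rw [h1, Int.cast_zero] at h2
    exact (mul_eq_zero.1 h2.symm).resolve_left
      (pow_ne_zero _ (Nat.cast_ne_zero.2 hν₀.ne'))
  have hmain := bakerFun_eq_zero_of_extrapolation hp0 hu huv (fun _ => rfl) hν₀ hq hk hε hvd hT₀
    hκ1 hA hh hM hL hW hMT hTh hv hcard' hb₀ hb
    (by
      calc 2 * Real.exp h * L = Real.exp h * (2 * L) := by ring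
        _ ≤ Real.exp h * Real.exp h := by gcongr
        _ = _ := by rw [← Real.exp_add]; ring_nf)
    hl hκa hν hqn
    (fun x => by
      refine (hcn x).trans ?_
      calc _ ≤ Real.exp h * Real.exp (8 * d * T * h + 3 * M * h + d * κ * L * h) := by gcongr
        _ = _ := by
          rw [← Real.exp_add, hTdef]
          push_cast
          ring_nf)
    (fun z hz => by
      set X := 3 * Real.exp W * A ^ J * h
      have hX : 0 ≤ X := by positivity
      have hLK : 2 * K * L ≤ Real.exp (2 * K * L * h) := by
        refine le_trans ?_ (Real.add_one_le_exp _)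
        have : 0 ≤ 2 * K * L := by positivity
        nlinarith
      have hXK : X ≤ K * Real.exp (K * X) := by
        calc X ≤ K * X := le_mul_of_one_le_left hX hK
          _ ≤ 1 * Real.exp (K * X) := by linarith [Real.add_one_le_exp (K * X)]
          _ ≤ _ := by gcongr
      calc ‖ε‖ * L * (‖u z‖ + X)
          ≤ |Λ| * L * (K * Real.exp (K * X) + K * Real.exp (K * X)) := by
            gcongr
            exact (hun z).trans (by gcongr)
        _ ≤ Real.exp (-((2 * K * L + K * (3 * Real.exp W * A ^ J)) * h)) * L *
            (K * Real.exp (K * X) + K * Real.exp (K * X)) := by gcongr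
        _ = (2 * K * L) * Real.exp (-((2 * K * L + K * (3 * Real.exp W * A ^ J)) * h)) *
            Real.exp (K * X) := by ring
        _ ≤ Real.exp (2 * K * L * h) *
            Real.exp (-((2 * K * L + K * (3 * Real.exp W * A ^ J)) * h)) *
            Real.exp (K * X) := by gcongr
        _ = 1 := by
          rw [← Real.exp_add, ← Real.exp_add, Real.exp_eq_one_iff]
          ring)
    hH0
  have hcz := eq_zero_of_sum_binomProd_mul_pow_eq_zero hp hinj (h := h) (fun x => (c x : ℂ)) ?_
  · funext x
    exact Int.cast_eq_zero.1 (congrFun hcz x)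
  · intro s hs
    have hs' : s < h * A ^ J := by
      refine hs.trans_le ?_
      calc L ^ d * (h * M) = h * (M * L ^ d) := by ring
        _ ≤ _ := by gcongr
    rw [← hmain s hs', bakerFun_natCast hp0 hu (fun _ => rfl)]
    simp only [iteratedTwist_zero]
    rfl

theorem exists_exp_neg_lt_abs_linearForm (hp : ∀ i, (p i).Prime) (hinj : Function.Injective p) :
    ∃ C h₀ : ℕ, ∀ h : ℕ, h₀ ≤ h → ∀ (b₀ : ℤ) (b : Fin d → ℤ), |(b₀ : ℝ)| ≤ Real.exp h →
      (∀ i, |(b i : ℝ)| ≤ Real.exp h) → b ≠ 0 →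
      Real.exp (-(C * h)) < |b₀ + ∑ i, b i * Real.log (p i)| := by
  rcases Nat.eq_zero_or_pos d with rfl | hd
  · exact ⟨0, 0, fun _ _ _ b _ _ hb => absurd (Subsingleton.elim b 0) hb⟩
  set κ := 1 + ∑ i, Real.log (p i) with hκdef
  have hκ0 : ∀ i ∈ univ, 0 ≤ Real.log (p i) := fun i _ => Real.log_natCast_nonneg _
  have hκ1 : 1 ≤ κ := by linarith [sum_nonneg hκ0]
  have hκ : ∀ i, Real.log (p i) ≤ κ := fun i => by
    linarith [single_le_sum hκ0 (mem_univ i)]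
  obtain ⟨J, T₀, A, M, L, W, hT₀, hA, hM, hL, hW, hMT, hML, hMA⟩ :=
    exists_baker_parameters d hd κ
  obtain ⟨u, v, K, hK, huv, hvd, hv, hu, hun⟩ := exists_flat_interpolation (2 ^ J * T₀)
  obtain ⟨C, hC⟩ := exists_nat_ge (2 * K * L + K * (3 * Real.exp W * A ^ J))
  refine ⟨C, d * (2 ^ J * T₀) + 2 * L + 4 * (2 ^ J * T₀) ^ d + 1, fun h hh b₀ b hb₀ hb hb0 => ?_⟩
  obtain ⟨k, hk⟩ := Function.ne_iff.1 hb0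
  have h1 : (1 : ℝ) + h + h ^ 2 / 2 ≤ Real.exp h :=
    Real.quadratic_le_exp_of_nonneg (Nat.cast_nonneg h)
  have h2 : (2 * L : ℝ) ≤ h := by exact_mod_cast (by omega : 2 * L ≤ h)
  have h3 : (4 * (2 ^ J * T₀) ^ d : ℝ) ≤ h := by
    exact_mod_cast (by omega : 4 * (2 ^ J * T₀) ^ d ≤ h)
  have h4 : (0 : ℝ) ≤ h := Nat.cast_nonneg h
  refine lt_of_le_of_lt ?_ (exp_neg_lt_abs_linearForm_of_parameters hp hinj hκ1 hκ hT₀ hA hM hL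
    hW hMT hML hMA hK huv hvd hv hu hun (h := h) (by omega) (by omega) ?_ ?_ hb₀ hb hk)
  · gcongr
  · nlinarith
  · nlinarith

theorem exists_div_pow_le_abs_linearForm (hp : ∀ i, (p i).Prime) (hinj : Function.Injective p) :
    ∃ (C : ℕ) (c : ℝ), 0 < c ∧ ∀ N : ℕ, 1 ≤ N → ∀ (b₀ : ℤ) (b : Fin d → ℤ),
      (∀ i, |b i| ≤ N) → b ≠ 0 → c / N ^ C ≤ |b₀ + ∑ i, b i * Real.log (p i)| := by
  obtain ⟨C, h₀, hC⟩ := exists_exp_neg_lt_abs_linearForm hp hinj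
  have hl0 : ∀ i ∈ univ, 0 ≤ Real.log (p i) := fun i _ => Real.log_natCast_nonneg _
  obtain ⟨D, hD⟩ := exists_nat_ge (1 + ∑ i, Real.log (p i))
  have hD1 : (1 : ℝ) ≤ D := by linarith [sum_nonneg hl0]
  refine ⟨C, Real.exp (-(C * (h₀ + 1))) / D ^ C, by positivity, fun N hN b₀ b hb hb0 => ?_⟩
  have hN' : (1 : ℝ) ≤ N := by exact_mod_cast hN
  have hDN : 0 < (D : ℝ) * N := by positivity
  have hb' : ∀ i, |(b i : ℝ)| ≤ N := fun i => by exact_mod_cast hb i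
  by_cases hb₀ : |(b₀ : ℝ)| ≤ D * N
  · set h := h₀ + ⌈Real.log (D * N)⌉₊
    have h1 : D * N ≤ Real.exp h := by
      rw [← Real.log_le_iff_le_exp hDN]
      refine (Nat.le_ceil _).trans ?_
      exact Nat.cast_le.2 (Nat.le_add_left _ h₀)
    have h2 : (N : ℝ) ≤ Real.exp h := le_trans (le_mul_of_one_le_left (by positivity) hD1) h1
    refine le_trans ?_ (hC h (Nat.le_add_right _ _) b₀ b (hb₀.trans h1)
      (fun i => (hb' i).trans h2) hb0).le
    have h3 : (h : ℝ) ≤ h₀ + (Real.log (D * N) + 1) := by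
      have := (Nat.ceil_lt_add_one (Real.log_nonneg (one_le_mul_of_one_le_of_one_le hD1 hN'))).le
      simp only [h, Nat.cast_add]
      gcongr
    calc Real.exp (-(C * (h₀ + 1))) / D ^ C / N ^ C
        = Real.exp (-(C * (h₀ + 1))) / Real.exp (Real.log (D * N)) ^ C := by
          rw [Real.exp_log hDN, mul_pow, div_div]
      _ = Real.exp (-(C * (h₀ + (Real.log (D * N) + 1)))) := by
          rw [← Real.exp_nat_mul, ← Real.exp_sub]
          ring_nf
      _ ≤ _ := by gcongr
  · have h1 : |∑ i, b i * Real.log (p i)| ≤ N * ∑ i, Real.log (p i) := by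
      rw [mul_sum]
      refine (abs_sum_le_sum_abs _ _).trans (sum_le_sum fun i hi => ?_)
      rw [abs_mul, abs_of_nonneg (hl0 i hi)]
      exact mul_le_mul_of_nonneg_right (hb' i) (hl0 i hi)
    have h2 : (1 + ∑ i, Real.log (p i)) * N ≤ D * N := by gcongr
    have h3 := abs_sub_abs_le_abs_sub (b₀ : ℝ) (-∑ i, b i * Real.log (p i))
    rw [abs_neg, sub_neg_eq_add] at h3
    calc Real.exp (-(C * (h₀ + 1))) / D ^ C / N ^ C ≤ 1 := by
          rw [div_div]
          refine div_le_one_of_le₀ ?_ (by positivity)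
          calc Real.exp (-(C * (h₀ + 1))) ≤ 1 := by
                rw [Real.exp_le_one_iff]; linarith [show (0 : ℝ) ≤ C * (h₀ + 1) by positivity]
            _ ≤ _ := one_le_mul_of_one_le_of_one_le (one_le_pow₀ hD1) (one_le_pow₀ hN')
      _ ≤ _ := by linarith

end LinearForms

section Fejer

/-- The character `t ↦ exp (2 π i t)`. -/
noncomputable def unitExp (t : ℝ) : ℂ := Complex.exp (2 * Real.pi * t * Complex.I)

theorem unitExp_add (s t : ℝ) : unitExp (s + t) = unitExp s * unitExp t := by
  simp only [unitExp, ← Complex.exp_add]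
  push_cast
  ring_nf

theorem unitExp_zero : unitExp 0 = 1 := by simp [unitExp]

theorem unitExp_intCast (n : ℤ) : unitExp n = 1 := by
  rw [unitExp, Complex.exp_eq_one_iff]
  exact ⟨n, by push_cast; ring⟩

theorem unitExp_natCast_mul (n : ℕ) (t : ℝ) : unitExp (n * t) = unitExp t ^ n := by
  rw [unitExp, unitExp, ← Complex.exp_nat_mul]
  push_cast
  ring_nf

theorem unitExp_sum {ι : Type*} (s : Finset ι) (f : ι → ℝ) :
    unitExp (∑ i ∈ s, f i) = ∏ i ∈ s, unitExp (f i) := by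
  simp only [unitExp, ← Complex.exp_sum]
  push_cast
  rw [mul_sum, sum_mul]

theorem norm_unitExp (t : ℝ) : ‖unitExp t‖ = 1 := by
  rw [unitExp, ← Complex.norm_exp_ofReal_mul_I (2 * Real.pi * t)]
  push_cast
  rfl

theorem conj_unitExp (t : ℝ) : (starRingEnd ℂ) (unitExp t) = unitExp (-t) := by
  rw [unitExp, unitExp, ← Complex.exp_conj]
  simp [show (starRingEnd ℂ) 2 = 2 from map_ofNat _ 2]

theorem four_mul_le_norm_unitExp_sub_one {t ε : ℝ} (h : ∀ m : ℤ, ε ≤ |t - m|) :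
    4 * ε ≤ ‖unitExp t - 1‖ := by
  have h1 : unitExp t = unitExp (t - round t) := by
    conv_lhs => rw [show t = (t - round t) + (round t : ℤ) by ring, unitExp_add, unitExp_intCast,
      mul_one]
  set y := t - round t with hy
  have hy2 : |y| ≤ 1 / 2 := abs_sub_round t
  have h2 := h (round t)
  rw [← hy] at h2
  have hπ := Real.pi_pos
  have h3 : ‖unitExp y - 1‖ = 2 * |Real.sin (Real.pi * y)| := by
    have := Complex.norm_exp_I_mul_ofReal_sub_one (2 * Real.pi * y)
    rw [show 2 * Real.pi * y / 2 = Real.pi * y by ring, norm_mul, Real.norm_eq_abs,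
      Real.norm_eq_abs, abs_two] at this
    rw [← this, unitExp]
    push_cast
    ring_nf
  have h4 : 2 / Real.pi * |Real.pi * y| ≤ |Real.sin (Real.pi * y)| := by
    refine Real.mul_abs_le_abs_sin ?_
    rw [abs_mul, abs_of_pos hπ]
    nlinarith
  rw [abs_mul, abs_of_pos hπ, ← mul_assoc, div_mul_cancel₀ _ hπ.ne'] at h4
  rw [h1, h3]
  linarith

theorem norm_sum_unitExp_le {t ε : ℝ} (hε : 0 < ε) (h : ∀ m : ℤ, ε ≤ |t - m|) (N : ℕ) :
    ‖∑ n ∈ range N, unitExp (n * t)‖ ≤ 1 / (2 * ε) := by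
  have h1 := four_mul_le_norm_unitExp_sub_one h
  have h2 : unitExp t ≠ 1 := by
    intro h3
    rw [h3, sub_self, norm_zero] at h1
    linarith
  simp only [unitExp_natCast_mul]
  rw [geom_sum_eq h2, norm_div]
  have h3 : ‖unitExp t ^ N - 1‖ ≤ 2 := by
    refine (norm_sub_le _ _).trans ?_
    rw [norm_pow, norm_unitExp, one_pow, norm_one]
    norm_num
  calc _ ≤ 2 / (4 * ε) := by gcongr
    _ = _ := by field_simp; norm_num

/-- The Fejér kernel of order `N` centred at `j / N`, divided by `N`. -/
noncomputable def fejerWeight (N j : ℕ) (x : ℝ) : ℝ :=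
  ‖∑ k ∈ range N, unitExp (k * (x - j / N))‖ ^ 2 / N ^ 2

theorem fejerWeight_nonneg (N j : ℕ) (x : ℝ) : 0 ≤ fejerWeight N j x := by
  unfold fejerWeight
  positivity

theorem fejerWeight_le {N j : ℕ} {x ε : ℝ} (hε : 0 < ε) (h : ∀ m : ℤ, ε ≤ |x - j / N - m|) :
    fejerWeight N j x ≤ 1 / (4 * ε ^ 2 * N ^ 2) := by
  have h1 := norm_sum_unitExp_le hε h N
  unfold fejerWeight
  calc _ ≤ (1 / (2 * ε)) ^ 2 / N ^ 2 := by gcongr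
    _ = _ := by rw [div_pow, div_div]; ring_nf

theorem ofReal_fejerWeight (N j : ℕ) (x : ℝ) : (fejerWeight N j x : ℂ) =
    ∑ y ∈ range N ×ˢ range N, 1 / (N : ℂ) ^ 2 *
      unitExp (-((y.1 - y.2) * (j / N : ℝ))) * unitExp ((y.1 - y.2) * x) := by
  rw [fejerWeight]
  push_cast
  rw [← Complex.mul_conj', map_sum, sum_mul_sum, sum_product, sum_div]
  refine sum_congr rfl fun k _ => ?_
  rw [sum_div]
  refine sum_congr rfl fun l _ => ?_
  rw [conj_unitExp, ← unitExp_add, mul_assoc, ← unitExp_add, div_eq_mul_one_div, mul_comm]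
  congr 2
  ring

theorem sum_unitExp_div {N k l : ℕ} (hN : 0 < N) (hk : k < N) (hl : l < N) :
    ∑ j ∈ range N, unitExp (-((k - l : ℝ) * (j / N : ℝ))) = if k = l then (N : ℂ) else 0 := by
  have hN' : (N : ℝ) ≠ 0 := by exact_mod_cast hN.ne'
  split_ifs with h
  · simp [h, unitExp_zero]
  · have h1 : ∀ j : ℕ, unitExp (-((k - l : ℝ) * (j / N : ℝ))) = unitExp ((l - k) / N) ^ j := by
      intro j
      rw [← unitExp_natCast_mul]
      congr 1
      ring
    simp only [h1]
    have h2 : unitExp ((l - k) / N) ≠ 1 := by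
      rw [unitExp, Ne, Complex.exp_eq_one_iff]
      rintro ⟨n, hn⟩
      have h3 : ((l - k : ℝ) / N : ℝ) = n := by
        have hc : (2 * Real.pi * Complex.I : ℂ) ≠ 0 := Complex.two_pi_I_ne_zero
        have h4 : (2 * Real.pi * Complex.I : ℂ) * (((l - k : ℝ) / N : ℝ) : ℂ) =
            (2 * Real.pi * Complex.I) * n := by
          linear_combination hn
        exact_mod_cast mul_left_cancel₀ hc h4
      rw [div_eq_iff hN'] at h3
      have h5 : (l : ℤ) - k = n * N := by exact_mod_cast h3
      have h6 : (N : ℤ) ∣ l - k := ⟨n, by rw [h5]; ring⟩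
      have h7 := Int.eq_zero_of_abs_lt_dvd h6 (by rw [abs_lt]; omega)
      omega
    rw [geom_sum_eq h2, ← unitExp_natCast_mul, mul_div_cancel₀ _ hN']
    have := unitExp_intCast ((l : ℤ) - k)
    push_cast at this
    rw [this, sub_self, zero_div]

theorem sum_fejerWeight {N : ℕ} (hN : 0 < N) (x : ℝ) : ∑ j ∈ range N, fejerWeight N j x = 1 := by
  have h1 : ((∑ j ∈ range N, fejerWeight N j x : ℝ) : ℂ) = 1 := by
    push_cast
    simp only [ofReal_fejerWeight]
    rw [sum_comm, sum_product]
    have h2 : ∀ k ∈ range N, ∑ l ∈ range N, ∑ j ∈ range N, 1 / (N : ℂ) ^ 2 *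
        unitExp (-((k - l : ℝ) * (j / N : ℝ))) * unitExp ((k - l : ℝ) * x) = (1 / N : ℂ) := by
      intro k hk
      have h3 : ∀ l ∈ range N, ∑ j ∈ range N, 1 / (N : ℂ) ^ 2 *
          unitExp (-((k - l : ℝ) * (j / N : ℝ))) * unitExp ((k - l : ℝ) * x) =
          if k = l then 1 / (N : ℂ) else 0 := by
        intro l hl
        rw [← sum_mul, ← mul_sum, sum_unitExp_div hN (mem_range.1 hk) (mem_range.1 hl)]
        split_ifs with h
        · rw [h, sub_self, zero_mul, unitExp_zero]
          have : (N : ℂ) ≠ 0 := by exact_mod_cast hN.ne'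
          field_simp
        · simp
      rw [sum_congr rfl h3, sum_ite_eq, if_pos hk]
    rw [sum_congr rfl h2]
    have : (N : ℂ) ≠ 0 := by exact_mod_cast hN.ne'
    simp [this]
  exact_mod_cast h1

end Fejer

section FejerSum

theorem unitExp_intCast_mul_fract (m : ℤ) (t : ℝ) :
    unitExp (m * Int.fract t) = unitExp (m * t) := by
  have h1 : (m : ℝ) * t = m * Int.fract t + ((m * ⌊t⌋ : ℤ) : ℝ) := by
    push_cast
    rw [← mul_add, Int.fract_add_floor]
  rw [h1, unitExp_add, unitExp_intCast, mul_one]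

/-- The trigonometric polynomial obtained by summing the Fejér weights centred at `j / N`, for
`j ∈ G`. -/
noncomputable def fejerSum (N : ℕ) (G : Finset ℕ) (x : ℝ) : ℝ := ∑ j ∈ G, fejerWeight N j x

/-- The coefficients of `fejerSum`. -/
noncomputable def fejerCoeff (N : ℕ) (G : Finset ℕ) (y : ℕ × ℕ) : ℂ :=
  ∑ j ∈ G, 1 / (N : ℂ) ^ 2 * unitExp (-((y.1 - y.2 : ℝ) * (j / N : ℝ)))

variable {N : ℕ} {G : Finset ℕ}

theorem fejerSum_nonneg (x : ℝ) : 0 ≤ fejerSum N G x :=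
  sum_nonneg fun _ _ => fejerWeight_nonneg _ _ _

theorem fejerSum_add_fejerSum_sdiff (hN : 0 < N) (hG : G ⊆ range N) (x : ℝ) :
    fejerSum N G x + fejerSum N (range N \ G) x = 1 := by
  rw [add_comm, ← sum_fejerWeight hN x]
  exact sum_sdiff hG

theorem fejerSum_le_one (hN : 0 < N) (hG : G ⊆ range N) (x : ℝ) : fejerSum N G x ≤ 1 := by
  linarith [fejerSum_add_fejerSum_sdiff hN hG x, fejerSum_nonneg (N := N) (G := range N \ G) x]

theorem fejerSum_le (hN : 0 < N) (hG : G ⊆ range N) {x ε : ℝ} (hε : 0 < ε)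
    (h : ∀ j ∈ G, ∀ m : ℤ, ε ≤ |x - j / N - m|) : fejerSum N G x ≤ 1 / (4 * ε ^ 2 * N) := by
  have h1 : fejerSum N G x ≤ ∑ _j ∈ G, 1 / (4 * ε ^ 2 * N ^ 2) :=
    sum_le_sum fun j hj => fejerWeight_le hε (h j hj)
  refine h1.trans ?_
  have h2 : (G.card : ℝ) ≤ N := by
    exact_mod_cast (card_le_card hG).trans (card_range N).le
  rw [sum_const, nsmul_eq_mul]
  have hN' : (0 : ℝ) < N := by exact_mod_cast hN
  calc (G.card : ℝ) * (1 / (4 * ε ^ 2 * N ^ 2)) ≤ N * (1 / (4 * ε ^ 2 * N ^ 2)) := by gcongr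
    _ = _ := by field_simp

theorem ofReal_fejerSum (x : ℝ) : (fejerSum N G x : ℂ) =
    ∑ y ∈ range N ×ˢ range N, fejerCoeff N G y * unitExp ((y.1 - y.2 : ℝ) * x) := by
  simp only [fejerCoeff, sum_mul]
  rw [sum_comm, fejerSum]
  push_cast
  exact sum_congr rfl fun j _ => ofReal_fejerWeight N j x

theorem norm_fejerCoeff_le (hN : 0 < N) (hG : G ⊆ range N) (y : ℕ × ℕ) :
    ‖fejerCoeff N G y‖ ≤ 1 / N := by
  have h1 : ‖fejerCoeff N G y‖ ≤ ∑ _j ∈ G, 1 / (N : ℝ) ^ 2 := by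
    refine norm_sum_le_of_le _ fun j _ => ?_
    rw [norm_mul, norm_unitExp]
    simp
  refine h1.trans ?_
  have h2 : (G.card : ℝ) ≤ N := by
    exact_mod_cast (card_le_card hG).trans (card_range N).le
  rw [sum_const, nsmul_eq_mul]
  have hN' : (0 : ℝ) < N := by exact_mod_cast hN
  calc (G.card : ℝ) * (1 / N ^ 2) ≤ N * (1 / N ^ 2) := by gcongr
    _ = _ := by field_simp

theorem sum_fejerCoeff_diag (hN : 0 < N) :
    ∑ y ∈ range N ×ˢ range N, (if y.1 = y.2 then fejerCoeff N G y else 0) = (G.card : ℂ) / N := by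
  have hN' : (N : ℂ) ≠ 0 := by exact_mod_cast hN.ne'
  rw [sum_product]
  have h1 : ∀ k ∈ range N, ∑ l ∈ range N, (if k = l then fejerCoeff N G (k, l) else 0) =
      (G.card : ℂ) / N ^ 2 := by
    intro k hk
    rw [sum_ite_eq, if_pos hk, fejerCoeff]
    simp [unitExp_zero, div_eq_mul_inv]
  rw [sum_congr rfl h1]
  simp only [sum_const, card_range, nsmul_eq_mul]
  field_simp

theorem abs_sum_prod_fejerSum_sub_le {d : ℕ} (hN : 0 < N) {G : Fin d → Finset ℕ}
    (hG : ∀ i, G i ⊆ range N) {a θ : Fin d → ℝ} {ε : ℝ} (hε : 0 < ε)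
    (ha : ∀ m : Fin d → ℤ, m ≠ 0 → (∀ i, |m i| ≤ N) → ∀ b : ℤ, ε ≤ |∑ i, m i * a i - b|) (X : ℕ) :
    |∑ n ∈ Icc 1 X, ∏ i, fejerSum N (G i) (Int.fract (n * a i - θ i)) -
      X * ∏ i, ((G i).card : ℝ) / N| ≤ N ^ d / (2 * ε) := by
  set Ω := Fintype.piFinset fun _ : Fin d => range N ×ˢ range N with hΩ
  set A : (Fin d → ℕ × ℕ) → ℂ := fun y => ∏ i, fejerCoeff N (G i) (y i) with hA
  have hN' : (0 : ℝ) < N := by exact_mod_cast hN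
  have h1 : ∀ n : ℕ, ∏ i, (fejerSum N (G i) (Int.fract (n * a i - θ i)) : ℂ) =
      ∑ y ∈ Ω, A y * (unitExp (-∑ i, ((y i).1 - (y i).2 : ℝ) * θ i) *
        unitExp (n * ∑ i, ((y i).1 - (y i).2 : ℝ) * a i)) := by
    intro n
    simp only [ofReal_fejerSum]
    rw [prod_univ_sum]
    refine sum_congr rfl fun y _ => ?_
    rw [prod_mul_distrib, ← unitExp_add, ← sum_neg_distrib, mul_sum, ← sum_add_distrib, unitExp_sum]
    congr 1
    refine prod_congr rfl fun i _ => ?_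
    have := unitExp_intCast_mul_fract ((y i).1 - (y i).2) (n * a i - θ i)
    push_cast at this
    rw [this]
    congr 1
    ring
  have h2 : ((X : ℂ) * ∏ i, ((G i).card : ℂ) / N) =
      ∑ y ∈ Ω, A y * (if ∀ i, (y i).1 = (y i).2 then (X : ℂ) else 0) := by
    have h3 : ∏ i, ((G i).card : ℂ) / N = ∑ y ∈ Ω, ∏ i,
        (if (y i).1 = (y i).2 then fejerCoeff N (G i) (y i) else 0) := by
      exact (prod_congr rfl fun i _ => (sum_fejerCoeff_diag hN).symm).trans
        (prod_univ_sum _ fun i y => if y.1 = y.2 then fejerCoeff N (G i) y else 0)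
    rw [h3, mul_sum]
    refine sum_congr rfl fun y _ => ?_
    rw [prod_ite_zero]
    simp only [mem_univ, true_imp_iff]
    split_ifs
    · rw [mul_comm]
    · simp
  have h4 : ∀ y ∈ Ω, ‖A y * (unitExp (-∑ i, ((y i).1 - (y i).2 : ℝ) * θ i) *
        ∑ n ∈ Icc 1 X, unitExp (n * ∑ i, ((y i).1 - (y i).2 : ℝ) * a i) -
        if ∀ i, (y i).1 = (y i).2 then (X : ℂ) else 0)‖ ≤ (1 / N) ^ d * (1 / (2 * ε)) := by
    intro y hy
    rw [norm_mul]
    refine mul_le_mul ?_ ?_ (norm_nonneg _) (by positivity)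
    · rw [hA, norm_prod]
      refine (prod_le_prod (fun _ _ => norm_nonneg _) fun i _ =>
        norm_fejerCoeff_le hN (hG i) (y i)).trans (le_of_eq ?_)
      simp
    · split_ifs with h
      · have h5 : ∀ f : Fin d → ℝ, ∑ i, ((y i).1 - (y i).2 : ℝ) * f i = 0 := fun f =>
          sum_eq_zero fun i _ => by rw [h i, sub_self, zero_mul]
        simp only [h5, neg_zero, mul_zero, unitExp_zero]
        simp
        positivity
      · set w := ∑ i, ((y i).1 - (y i).2 : ℝ) * a i with hw
        have h5 : ∑ n ∈ Icc 1 X, unitExp (n * w) = unitExp w * ∑ n ∈ range X, unitExp (n * w) := by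
          rw [mul_sum, range_eq_Ico, sum_Ico_eq_sum_range, ← Ico_add_one_right_eq_Icc,
            sum_Ico_eq_sum_range]
          refine sum_congr (by simp) fun n _ => ?_
          rw [← unitExp_add]
          congr 1
          push_cast
          ring
        rw [sub_zero, h5, norm_mul, norm_mul, norm_unitExp, norm_unitExp, one_mul,
          one_mul]
        refine norm_sum_unitExp_le hε (fun b => ?_) X
        have h6 := ha (fun i => (y i).1 - (y i).2) ?_ ?_ b
        · push_cast at h6
          exact h6
        · intro h0
          refine h fun i => ?_
          have := congrFun h0 i
          simp only [Pi.zero_apply] at this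
          omega
        · intro i
          have := Fintype.mem_piFinset.1 hy i
          simp only [mem_product, mem_range] at this
          rw [abs_le]
          omega
  rw [← Real.norm_eq_abs, ← Complex.norm_real]
  push_cast
  simp only [h1]
  rw [sum_comm, h2, ← sum_sub_distrib]
  simp only [← mul_sum, ← mul_sub]
  refine (norm_sum_le_of_le _ h4).trans (le_of_eq ?_)
  rw [sum_const, nsmul_eq_mul, hΩ, Fintype.card_piFinset]
  simp only [card_product, card_range, prod_const, card_univ, Fintype.card_fin]
  push_cast
  rw [one_div, inv_pow, mul_pow]
  field_simp

end FejerSum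

section Approximation

theorem prod_le_prod_add_card_mul {ι : Type*} (s : Finset ι) {a b : ι → ℝ} {η : ℝ} (hη : 0 ≤ η)
    (ha : ∀ i, a i ∈ Set.Icc (0 : ℝ) 1) (hb : ∀ i, b i ∈ Set.Icc (0 : ℝ) 1)
    (h : ∀ i, a i ≤ b i + η) : ∏ i ∈ s, a i ≤ ∏ i ∈ s, b i + s.card * η := by
  induction s using Finset.induction_on with
  | empty => simp
  | insert i s hi ih =>
    rw [prod_insert hi, prod_insert hi, card_insert_of_notMem hi]
    have ha0 : 0 ≤ ∏ j ∈ s, a j := prod_nonneg fun j _ => (ha j).1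
    have ha1 : ∏ j ∈ s, a j ≤ 1 := prod_le_one (fun j _ => (ha j).1) fun j _ => (ha j).2
    have h1 : (a i - b i) * ∏ j ∈ s, a j ≤ η :=
      (mul_le_mul_of_nonneg_right (by linarith [h i]) ha0).trans (mul_le_of_le_one_right hη ha1)
    have h2 : b i * (∏ j ∈ s, a j - ∏ j ∈ s, b j) ≤ s.card * η :=
      (mul_le_mul_of_nonneg_left (sub_le_iff_le_add'.2 ih) (hb i).1).trans
        (mul_le_of_le_one_left (by positivity) (hb i).2)
    push_cast
    linarith

theorem le_abs_sub_intCast {t ε : ℝ} (h₀ : ε ≤ t) (h₁ : t ≤ 1 - ε) (m : ℤ) : ε ≤ |t - m| := by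
  rcases le_or_gt m 0 with hm | hm
  · have : (m : ℝ) ≤ 0 := by exact_mod_cast hm
    exact le_trans (by linarith) (le_abs_self _)
  · have : (1 : ℝ) ≤ m := by exact_mod_cast hm
    exact le_trans (by linarith) (neg_le_abs _)

/-- Indices of the Fejér weights whose sum majorizes the indicator function of `[0, β]`. -/
noncomputable def outerIndices (N : ℕ) (ε β : ℝ) : Finset ℕ :=
  (range N).filter fun j => (j : ℝ) / N ≤ β + ε ∨ 1 - ε ≤ (j : ℝ) / N

/-- Indices of the Fejér weights whose sum minorizes the indicator function of `[0, β]`. -/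
noncomputable def innerIndices (N : ℕ) (ε β : ℝ) : Finset ℕ :=
  (range N).filter fun j => ε ≤ (j : ℝ) / N ∧ (j : ℝ) / N ≤ β - ε

variable {N : ℕ} {ε β x : ℝ}

theorem outerIndices_subset : outerIndices N ε β ⊆ range N := filter_subset _ _

theorem innerIndices_subset : innerIndices N ε β ⊆ range N := filter_subset _ _

theorem one_le_fejerSum_outerIndices_add (hN : 0 < N) (hε : 0 < ε) (hx : x ∈ Set.Icc 0 β) :
    1 ≤ fejerSum N (outerIndices N ε β) x + 1 / (4 * ε ^ 2 * N) := by
  have hG : outerIndices N ε β ⊆ range N := outerIndices_subset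
  refine (fejerSum_add_fejerSum_sdiff hN hG x).symm.le.trans (add_le_add_right ?_ _)
  refine fejerSum_le hN sdiff_subset hε fun j hj m => ?_
  simp only [outerIndices, Finset.mem_sdiff, mem_filter, not_and, not_or, not_le] at hj
  have hj' := hj.2 hj.1
  have := le_abs_sub_intCast (t := j / N - x) (ε := ε)
    (by linarith [hx.2]) (by linarith [hx.1]) (-m)
  rw [← abs_neg] at this
  convert this using 2
  push_cast
  ring

theorem fejerSum_innerIndices_le (hN : 0 < N) (hε : 0 < ε) (hx : β < x) (hx₁ : x ≤ 1) :
    fejerSum N (innerIndices N ε β) x ≤ 1 / (4 * ε ^ 2 * N) := by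
  refine fejerSum_le hN innerIndices_subset hε fun j hj m => ?_
  simp only [innerIndices, mem_filter] at hj
  exact le_abs_sub_intCast (by linarith [hj.2.2]) (by linarith [hj.2.1]) m

theorem card_div_le_one {G : Finset ℕ} (hG : G ⊆ range N) : (G.card : ℝ) / N ≤ 1 := by
  refine div_le_one_of_le₀ ?_ (by positivity)
  exact_mod_cast (card_le_card hG).trans (card_range N).le

theorem card_outerIndices_div_le (hN : 0 < N) (hε : 0 < ε) (hNε : 1 ≤ N * ε) (hβ : 0 ≤ β) :
    ((outerIndices N ε β).card : ℝ) / N ≤ β + 4 * ε := by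
  have hN' : (0 : ℝ) < N := by exact_mod_cast hN
  rw [div_le_iff₀ hN']
  have h1 : outerIndices N ε β ⊆
      range (⌊N * (β + ε)⌋₊ + 1) ∪ (range (⌊N * ε⌋₊ + 1)).image fun k => N - k := by
    intro j hj
    simp only [outerIndices, mem_filter, mem_range, div_le_iff₀ hN', le_div_iff₀ hN'] at hj
    simp only [mem_union, mem_range, mem_image]
    rcases hj.2 with h | h
    · exact Or.inl (Nat.lt_succ_of_le (Nat.le_floor (by linarith)))
    · refine Or.inr ⟨N - j, Nat.lt_succ_of_le (Nat.le_floor ?_), by omega⟩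
      rw [Nat.cast_sub hj.1.le]
      linarith
  have h2 := (card_le_card h1).trans ((card_union_le _ _).trans
    (add_le_add_right card_image_le _))
  rw [card_range, card_range] at h2
  have h3 : ((outerIndices N ε β).card : ℝ) ≤ (⌊N * (β + ε)⌋₊ + 1) + (⌊N * ε⌋₊ + 1) := by
    exact_mod_cast h2
  have h4 := Nat.floor_le (show 0 ≤ N * (β + ε) by positivity)
  have h5 := Nat.floor_le (show 0 ≤ N * ε by positivity)
  linarith

theorem le_card_innerIndices_div (hN : 0 < N) (hε : 0 < ε) (hNε : 1 ≤ N * ε) (hβ : β ≤ 1) :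
    β ≤ ((innerIndices N ε β).card : ℝ) / N + 4 * ε := by
  have hN' : (0 : ℝ) < N := by exact_mod_cast hN
  rcases lt_or_ge β ε with hβε | hβε
  · have : 0 ≤ ((innerIndices N ε β).card : ℝ) / N := by positivity
    linarith
  have h1 : Icc ⌈N * ε⌉₊ ⌊N * (β - ε)⌋₊ ⊆ innerIndices N ε β := by
    intro j hj
    rw [mem_Icc, Nat.ceil_le, Nat.le_floor_iff (mul_nonneg hN'.le (sub_nonneg.2 hβε))] at hj
    simp only [innerIndices, mem_filter, mem_range, div_le_iff₀ hN', le_div_iff₀ hN']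
    refine ⟨?_, by linarith, by linarith⟩
    have : (j : ℝ) < N := hj.2.trans_lt (mul_lt_of_lt_one_right hN' (by linarith))
    exact_mod_cast this
  have h2 := card_le_card h1
  rw [Nat.card_Icc] at h2
  have h3 : ((⌊N * (β - ε)⌋₊ + 1 : ℕ) : ℝ) ≤ (innerIndices N ε β).card + (⌈N * ε⌉₊ : ℕ) := by
    exact_mod_cast Nat.sub_le_iff_le_add.1 h2
  have h4 := Nat.lt_floor_add_one (N * (β - ε))
  have h5 := Nat.ceil_lt_add_one (show 0 ≤ N * ε by positivity)
  rw [← sub_le_iff_le_add, le_div_iff₀ hN']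
  push_cast at h3
  linarith

theorem abs_card_filter_fract_sub_le {d : ℕ} (hN : 0 < N) (hε : 0 < ε) (hNε : 1 ≤ N * ε)
    {a θ β : Fin d → ℝ} {κ : ℝ} (hκ : 0 < κ)
    (ha : ∀ m : Fin d → ℤ, m ≠ 0 → (∀ i, |m i| ≤ N) → ∀ b : ℤ, κ ≤ |∑ i, m i * a i - b|)
    (hβ : ∀ i, β i ∈ Set.Icc (0 : ℝ) 1) (X : ℕ) :
    |(((Icc 1 X).filter fun n : ℕ =>
        ∀ i, Int.fract ((n : ℝ) * a i - θ i) ∈ Set.Icc (0 : ℝ) (β i)).card : ℝ) -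
      X * ∏ i, β i| ≤ X * (d * (4 * ε + 1 / (4 * ε ^ 2 * N))) + N ^ d / (2 * κ) := by
  set η := 1 / (4 * ε ^ 2 * N) with hη
  have hη0 : 0 ≤ η := by positivity
  set χ : ℕ → Fin d → ℝ := fun n i =>
    if Int.fract ((n : ℝ) * a i - θ i) ∈ Set.Icc (0 : ℝ) (β i) then 1 else 0 with hχ
  have hχ01 : ∀ n i, χ n i ∈ Set.Icc (0 : ℝ) 1 := by
    intro n i
    simp only [hχ]
    split_ifs <;> simp
  have hcount : (((Icc 1 X).filter fun n : ℕ =>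
      ∀ i, Int.fract ((n : ℝ) * a i - θ i) ∈ Set.Icc (0 : ℝ) (β i)).card : ℝ) =
      ∑ n ∈ Icc 1 X, ∏ i, χ n i := by
    rw [← sum_boole]
    refine sum_congr rfl fun n _ => ?_
    simp only [hχ]
    rw [prod_ite_zero]
    simp
  have hfejer : ∀ {G : Fin d → Finset ℕ}, (∀ i, G i ⊆ range N) → ∀ (n : ℕ) i,
      fejerSum N (G i) (Int.fract (n * a i - θ i)) ∈ Set.Icc (0 : ℝ) 1 := fun hG n i =>
    ⟨fejerSum_nonneg _, fejerSum_le_one hN (hG i) _⟩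
  have hcard : ∀ {G : Fin d → Finset ℕ}, (∀ i, G i ⊆ range N) → ∀ i,
      ((G i).card : ℝ) / N ∈ Set.Icc (0 : ℝ) 1 := fun hG i =>
    ⟨by positivity, card_div_le_one (hG i)⟩
  have hsum : ∀ {f g : ℕ → ℝ}, (∀ n, f n ≤ g n + d * η) →
      ∑ n ∈ Icc 1 X, f n ≤ ∑ n ∈ Icc 1 X, g n + X * (d * η) := by
    intro f g hfg
    refine (sum_le_sum fun n _ => hfg n).trans (le_of_eq ?_)
    simp [sum_add_distrib]
  have hX : (0 : ℝ) ≤ X := Nat.cast_nonneg X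
  have hGo : ∀ i, outerIndices N ε (β i) ⊆ range N := fun _ => outerIndices_subset
  have hGi : ∀ i, innerIndices N ε (β i) ⊆ range N := fun _ => innerIndices_subset
  have hu := (abs_le.1 (abs_sum_prod_fejerSum_sub_le (θ := θ) hN hGo hκ ha X)).2
  have hl := (abs_le.1 (abs_sum_prod_fejerSum_sub_le (θ := θ) hN hGi hκ ha X)).1
  have hu1 := hsum fun n => by
    simpa using prod_le_prod_add_card_mul univ hη0 (hχ01 n) (hfejer hGo n) fun i => by
      simp only [hχ]
      split_ifs with h
      · exact one_le_fejerSum_outerIndices_add hN hε h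
      · exact add_nonneg (fejerSum_nonneg _) hη0
  have hl1 := hsum fun n => by
    simpa using prod_le_prod_add_card_mul univ hη0 (hfejer hGi n) (hχ01 n) fun i => by
      simp only [hχ]
      split_ifs with h
      · exact (fejerSum_le_one hN (hGi i) _).trans (le_add_of_nonneg_right hη0)
      · rw [zero_add]
        refine fejerSum_innerIndices_le hN hε ?_ (Int.fract_lt_one _).le
        by_contra! hle
        exact h ⟨Int.fract_nonneg _, hle⟩
  have hu2 := prod_le_prod_add_card_mul univ (show 0 ≤ 4 * ε by positivity) (hcard hGo) hβ fun i =>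
    card_outerIndices_div_le hN hε hNε (hβ i).1
  have hl2 := prod_le_prod_add_card_mul univ (show 0 ≤ 4 * ε by positivity) hβ (hcard hGi) fun i =>
    le_card_innerIndices_div hN hε hNε (hβ i).2
  rw [card_univ, Fintype.card_fin] at hu2 hl2
  have hu3 := mul_le_mul_of_nonneg_left hu2 hX
  have hl3 := mul_le_mul_of_nonneg_left hl2 hX
  rw [hcount, abs_le]
  constructor <;> linarith

end Approximation

/-- Filtering the image of `s` under the cast to `ℝ`, in the monadic form of the coercion, amounts
to filtering `s`. -/
theorem card_filter_bind_pure_cast (s : Finset ℕ) (q : ℝ → Prop)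
    [DecidablePred q] :
    ((do let a ← s; pure (a : ℝ) : Finset ℝ).filter q).card =
      (s.filter fun n : ℕ => q n).card := by
  have h : (do let a ← s; pure (a : ℝ) : Finset ℝ) = s.image Nat.cast := by
    ext t
    simp [eq_comm]
  rw [h, filter_image, card_image_of_injective _ Nat.cast_injective]

/-- Discrepancy bound. For distinct primes `p₁ < … < p_d`,
`α = (log p₁, …, log p_d)` and any `θ ∈ ℝ^d`, the discrepancy of the sequence
`(nα - θ mod 1)` is `O(x^{-δ})` for some `δ > 0`. -/
theorem discrepancy_polynomial_decay
    (d : ℕ) (p : Fin d → ℕ) (hp : ∀ i, (p i).Prime) (hmono : StrictMono p)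
    (θ : Fin d → ℝ) :
    ∃ δ > (0 : ℝ), ∃ C > (0 : ℝ), ∀ x : ℝ, 1 ≤ x → ∀ β : Fin d → ℝ,
      (∀ i, β i ∈ Set.Icc (0 : ℝ) 1) →
      |(1 / x) * (((Finset.Icc 1 ⌊x⌋₊).filter fun n =>
          ∀ i, Int.fract ((n : ℝ) * Real.log (p i) - θ i) ∈ Set.Icc (0 : ℝ) (β i)).card : ℝ)
        - ∏ i, β i| ≤ C * x ^ (-δ) := by
  obtain ⟨C, c, hc, hbaker⟩ := exists_div_pow_le_abs_linearForm hp hmono.injective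
  set E := d + C + 1 with hE
  have hE0 : (0 : ℝ) < E := by rw [hE]; positivity
  set δ : ℝ := 1 / (6 * E) with hδ
  refine ⟨δ, by positivity, 2 * (d * (17 / 4)) + 1 / (2 * c) + 1, by positivity,
    fun x hx β hβ => ?_⟩
  have hx0 : 0 < x := by linarith
  set y := x ^ δ with hy
  have hy1 : 1 ≤ y := Real.one_le_rpow hx (by positivity)
  have hyx : y ^ (6 * E) = x := by
    rw [hy, ← Real.rpow_natCast, ← Real.rpow_mul hx0.le, hδ]
    push_cast
    rw [one_div_mul_cancel (by positivity), Real.rpow_one]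
  rw [Real.rpow_neg hx0.le, ← hy]
  set Q := ⌊y⌋₊ with hQ
  have hQ1 : 1 ≤ Q := (Nat.one_le_floor_iff _).2 hy1
  have hQ1' : (1 : ℝ) ≤ Q := by exact_mod_cast hQ1
  have hQy : (Q : ℝ) ≤ y := Nat.floor_le (by linarith)
  have hyQ : 1 / (Q : ℝ) ≤ 2 * y⁻¹ := by
    have := Nat.lt_floor_add_one y
    rw [← div_eq_mul_inv, div_le_div_iff₀ (by linarith) (by linarith)]
    linarith
  have hN : 0 < Q ^ 3 := by positivity
  have hNε : 1 ≤ ((Q ^ 3 : ℕ) : ℝ) * (1 / Q) := by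
    push_cast
    rw [mul_one_div, pow_succ, mul_div_cancel_right₀ _ (by positivity)]
    exact one_le_pow₀ hQ1'
  have hκ : 0 < c / ((Q ^ 3 : ℕ) : ℝ) ^ C := by positivity
  have key := abs_card_filter_fract_sub_le (a := fun i => Real.log (p i)) (θ := θ) hN
    (show (0 : ℝ) < 1 / Q by positivity) hNε hκ (fun m hm hmN b => by
      have := hbaker (Q ^ 3) hN (-b) m hmN hm
      push_cast at this ⊢
      rwa [neg_add_eq_sub] at this) hβ ⌊x⌋₊
  rw [card_filter_bind_pure_cast (Icc 1 ⌊x⌋₊) fun t : ℝ =>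
    ∀ i, Int.fract (t * Real.log (p i) - θ i) ∈ Set.Icc (0 : ℝ) (β i)]
  set count := (((Finset.Icc 1 ⌊x⌋₊).filter fun n : ℕ =>
    ∀ i, Int.fract ((n : ℝ) * Real.log (p i) - θ i) ∈ Set.Icc (0 : ℝ) (β i)).card : ℝ)
  set P := ∏ i, β i
  have hP0 : 0 ≤ P := prod_nonneg fun i _ => (hβ i).1
  have hP1 : P ≤ 1 := prod_le_one (fun i _ => (hβ i).1) fun i _ => (hβ i).2
  have hX := Nat.floor_le hx0.le
  have hX' := Nat.lt_floor_add_one x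
  have hmain :
      4 * (1 / (Q : ℝ)) + 1 / (4 * (1 / (Q : ℝ)) ^ 2 * (Q ^ 3 : ℕ)) = 17 / 4 * (1 / Q) := by
    push_cast
    field_simp
    norm_num
  have herr : ((Q ^ 3 : ℕ) : ℝ) ^ d / (2 * (c / ((Q ^ 3 : ℕ) : ℝ) ^ C)) ≤
      1 / (2 * c) * (x * y⁻¹) := by
    have h1 : ((Q ^ 3 : ℕ) : ℝ) ^ d / (2 * (c / ((Q ^ 3 : ℕ) : ℝ) ^ C)) =
        1 / (2 * c) * (Q : ℝ) ^ (3 * (d + C)) := by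
      push_cast
      rw [pow_mul, pow_add]
      field_simp
    rw [h1]
    gcongr
    rw [← div_eq_mul_inv, le_div_iff₀ (by linarith)]
    calc (Q : ℝ) ^ (3 * (d + C)) * y ≤ y ^ (3 * (d + C)) * y := by gcongr
      _ = y ^ (3 * (d + C) + 1) := (pow_succ _ _).symm
      _ ≤ y ^ (6 * E) := pow_le_pow_right₀ hy1 (by omega)
      _ = x := hyx
  have hyx1 : 1 ≤ x * y⁻¹ := by
    rw [← div_eq_mul_inv, one_le_div (by linarith)]
    conv_rhs => rw [← hyx]
    exact le_self_pow₀ hy1 (by omega)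
  have hmid : (⌊x⌋₊ : ℝ) * (d * (17 / 4 * (1 / Q))) ≤ x * (d * (17 / 4 * (2 * y⁻¹))) := by gcongr
  rw [hmain] at key
  have hround : |⌊x⌋₊ * P - x * P| ≤ 1 := by
    rw [← sub_mul, abs_mul, abs_of_nonneg hP0]
    refine mul_le_one₀ (abs_le.2 ⟨by linarith, by linarith⟩) hP0 hP1
  have htri := abs_sub_le count (⌊x⌋₊ * P) (x * P)
  have hscale : 1 / x * count - P = (count - x * P) / x := by field_simp
  rw [hscale, abs_div, abs_of_pos hx0, div_le_iff₀ hx0]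
  linarith
end
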